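/- There exists a theory T in the language of set theory such that: (1) ZFC + "Ord is essentially subtle" proves every sentence of T; (2) ZFC + "Ord is essentially faint" + T proves the scheme "Ord is essentially subtle"; and (3) for every sentence φ in T, ZFC + ¬φ proves the scheme "Ord is essentially faint". -/

import Mathlib

namespace Paper

/-- First-order formulas in the language of set theory (one binary relation, membership),
using de Bruijn variables; `all` binds the last variable. -/
inductive SetFormula : ℕ → Type
  | mem {n : ℕ} (i j : Fin n) : SetFormula n
  | eq {n : ℕ} (i j : Fin n) : SetFormula n
  | fal {n : ℕ} : SetFormula n
  | imp {n : ℕ} (φ ψ : SetFormula n) : SetFormula n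
  | all {n : ℕ} (φ : SetFormula (n + 1)) : SetFormula n

namespace SetFormula

/-- Negation. -/
def not {n : ℕ} (φ : SetFormula n) : SetFormula n := φ.imp .fal

/-- Conjunction. -/
def and {n : ℕ} (φ ψ : SetFormula n) : SetFormula n := (φ.imp ψ.not).not

/-- Existential quantification (over the last variable). -/
def ex {n : ℕ} (φ : SetFormula (n + 1)) : SetFormula n := (SetFormula.all φ.not).not

end SetFormula

/-- Satisfaction of a set-theoretic formula in a structure `(M, E)`, where `E` interprets
the membership relation. -/
def Realize {M : Type*} (E : M → M → Prop) : ∀ {n : ℕ}, SetFormula n → (Fin n → M) → Prop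
  | _, .mem i j, v => E (v i) (v j)
  | _, .eq i j, v => v i = v j
  | _, .fal, _ => False
  | _, .imp φ ψ, v => Realize E φ v → Realize E ψ v
  | _, .all φ, v => ∀ a, Realize E φ (Fin.snoc v a)

/-- Satisfaction of a formula relativized to the subclass `S` of `M`; all quantifiers
range over `S`, and the assignment is required to take values in `S`. -/
def RealizeIn {M : Type*} (E : M → M → Prop) (S : M → Prop) {n : ℕ}
    (φ : SetFormula n) (v : Fin n → M) : Prop :=
  ∃ h : ∀ i, S (v i),
    Realize (fun a b : {x : M // S x} => E a.1 b.1) φ fun i => ⟨v i, h i⟩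

/-- `Δ₀`-formulas: formulas all of whose quantifiers are bounded. -/
inductive IsDelta0 : ∀ {n : ℕ}, SetFormula n → Prop
  | mem {n : ℕ} (i j : Fin n) : IsDelta0 (.mem i j)
  | eq {n : ℕ} (i j : Fin n) : IsDelta0 (.eq i j)
  | fal {n : ℕ} : IsDelta0 (n := n) .fal
  | imp {n : ℕ} {φ ψ : SetFormula n} : IsDelta0 φ → IsDelta0 ψ → IsDelta0 (φ.imp ψ)
  | ball {n : ℕ} (j : Fin n) {φ : SetFormula (n + 1)} :
      IsDelta0 φ → IsDelta0 (.all ((SetFormula.mem (Fin.last n) j.castSucc).imp φ))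
  | bex {n : ℕ} (j : Fin n) {φ : SetFormula (n + 1)} :
      IsDelta0 φ → IsDelta0 (SetFormula.ex ((SetFormula.mem (Fin.last n) j.castSucc).and φ))

mutual
  /-- `Σₙ`-formulas of the Lévy hierarchy. -/
  inductive IsSigma : ℕ → ∀ {n : ℕ}, SetFormula n → Prop
    | ofDelta0 {k n : ℕ} {φ : SetFormula n} : IsDelta0 φ → IsSigma k φ
    | ofPi {k n : ℕ} {φ : SetFormula n} : IsPi k φ → IsSigma (k + 1) φ
    | ex {k n : ℕ} {φ : SetFormula (n + 1)} : IsSigma (k + 1) φ → IsSigma (k + 1) φ.ex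
  /-- `Πₙ`-formulas of the Lévy hierarchy. -/
  inductive IsPi : ℕ → ∀ {n : ℕ}, SetFormula n → Prop
    | ofDelta0 {k n : ℕ} {φ : SetFormula n} : IsDelta0 φ → IsPi k φ
    | ofSigma {k n : ℕ} {φ : SetFormula n} : IsSigma k φ → IsPi (k + 1) φ
    | all {k n : ℕ} {φ : SetFormula (n + 1)} : IsPi (k + 1) φ → IsPi (k + 1) φ.all
end

end Paper
namespace Paper

section Generic

variable {M : Type*} (E : M → M → Prop)

/-- `x` is a transitive set (relative to the membership relation `E`). -/
def TransE (x : M) : Prop := ∀ y, E y x → ∀ z, E z y → E z x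

/-- `x` is an ordinal: a transitive set all of whose elements are transitive. -/
def OrdE (x : M) : Prop := TransE E x ∧ ∀ y, E y x → TransE E y

/-- `a ⊆ b`. -/
def SubE (a b : M) : Prop := ∀ z, E z a → E z b

/-- `a ≤ b` for ordinals. -/
def LeE (a b : M) : Prop := E a b ∨ a = b

/-- `x` is the empty set. -/
def EmptyE (x : M) : Prop := ∀ z, ¬ E z x

/-- `s = y ∪ {y}`. -/
def SuccSpecE (s y : M) : Prop := ∀ z, E z s ↔ (E z y ∨ z = y)

/-- `l` is a (nonzero) limit ordinal. -/
def LimitE (l : M) : Prop := OrdE E l ∧ (∃ w, E w l) ∧ ∀ α, E α l → ∃ β, E β l ∧ E α β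

/-- `w` is the first infinite ordinal `ω`. -/
def OmegaSpecE (w : M) : Prop := LimitE E w ∧ ∀ x, E x w → ¬ LimitE E x

/-- `x` is an infinite ordinal, i.e. an ordinal with `ω ≤ x`. -/
def InfiniteOrdE (x : M) : Prop := OrdE E x ∧ ∃ w, OmegaSpecE E w ∧ LeE E w x

/-- `p = {a, b}`. -/
def UPairE (p a b : M) : Prop := ∀ z, E z p ↔ (z = a ∨ z = b)

/-- `p` is the Kuratowski ordered pair `⟨a, b⟩`. -/
def OPairE (p a b : M) : Prop :=
  ∃ s t, UPairE E s a a ∧ UPairE E t a b ∧ UPairE E p s t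

/-- The ordered pair `⟨x, y⟩` is an element of `f`. -/
def PairMemE (f x y : M) : Prop := ∃ p, E p f ∧ OPairE E p x y

/-- `f` is (the graph of) a function from `a` to `b`. -/
def IsFuncE (f a b : M) : Prop :=
  (∀ p, E p f → ∃ x y, E x a ∧ E y b ∧ OPairE E p x y) ∧
    ∀ x, E x a → (∃ y, PairMemE E f x y) ∧
      ∀ y y', PairMemE E f x y → PairMemE E f x y' → y = y'

/-- `f` is a surjection from `a` onto `b`. -/
def SurjE (f a b : M) : Prop :=
  IsFuncE E f a b ∧ ∀ y, E y b → ∃ x, E x a ∧ PairMemE E f x y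

/-- `f` is an injection from `a` into `b`. -/
def InjE (f a b : M) : Prop :=
  IsFuncE E f a b ∧ ∀ x x' y, E x a → E x' a →
    PairMemE E f x y → PairMemE E f x' y → x = x'

/-- `f` is a bijection between `a` and `b`. -/
def BijE (f a b : M) : Prop := SurjE E f a b ∧ InjE E f a b

/-- `κ` is a cardinal: an ordinal not in bijection with any of its elements. -/
def CardE (κ : M) : Prop := OrdE E κ ∧ ∀ α, E α κ → ¬ ∃ f, BijE E f α κ

/-- `κ` is an infinite cardinal. -/
def InfCardE (κ : M) : Prop := CardE E κ ∧ InfiniteOrdE E κ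

/-- `b = a ∩ c`. -/
def InterSpecE (b a c : M) : Prop := ∀ z, E z b ↔ (E z a ∧ E z c)

/-- `c` is unbounded in the ordinal `κ`. -/
def UnboundedInE (c κ : M) : Prop := ∀ α, E α κ → ∃ β, E β c ∧ E α β

/-- `c` is closed in the ordinal `κ`: it contains each of its limit points below `κ`. -/
def ClosedInE (c κ : M) : Prop :=
  ∀ l, E l κ → (∃ w, E w l) → (∀ α, E α l → ∃ β, E β c ∧ E α β ∧ E β l) → E l c

/-- `c` is a closed unbounded subset of the ordinal `κ`. -/
def ClubInE (c κ : M) : Prop := SubE E c κ ∧ UnboundedInE E c κ ∧ ClosedInE E c κ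

/-- `f` is (the graph of) a sequence `⟨A_α | α < κ⟩` with `A_α ⊆ α` for all `α < κ`. -/
def SeqSpecE (f κ : M) : Prop :=
  ∀ α, E α κ → (∃ A, PairMemE E f α A ∧ SubE E A α) ∧
    ∀ A A', PairMemE E f α A → PairMemE E f α A' → A = A'

/-- `κ` is a subtle cardinal. -/
def SubtleE (κ : M) : Prop :=
  InfCardE E κ ∧ ∀ f, SeqSpecE E f κ → ∀ c, ClubInE E c κ →
    ∃ α β, E α c ∧ E β c ∧ E α β ∧
      ∃ A B, PairMemE E f α A ∧ PairMemE E f β B ∧ InterSpecE E A B α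

/-- `κ` is a regular ordinal: every function from an element of `κ` to `κ` has
bounded range. -/
def RegularE (κ : M) : Prop :=
  OrdE E κ ∧ ∀ γ f, E γ κ → IsFuncE E f γ κ →
    ∃ β, E β κ ∧ ∀ x y, PairMemE E f x y → E y β

/-- `p = 𝒫(a)`. -/
def PowSpecE (p a : M) : Prop := ∀ z, E z p ↔ SubE E z a

/-- `κ` is a strong limit cardinal: for every `α < κ`, `2^|α| < κ`. -/
def StrongLimitE (κ : M) : Prop :=
  ∀ α, E α κ → ∀ p, PowSpecE E p α → ∃ β f, E β κ ∧ InjE E f p β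

/-- `κ` is a strongly inaccessible cardinal: an uncountable regular strong limit
cardinal. -/
def InaccE (κ : M) : Prop :=
  CardE E κ ∧ (∃ w, OmegaSpecE E w ∧ E w κ) ∧ RegularE E κ ∧ StrongLimitE E κ

/-- `z` belongs to the transitive closure of `x`. -/
def TCMemE (z x : M) : Prop := ∀ t, TransE E t → SubE E x t → E z t

/-- `x ∈ H(θ)`: the transitive closure of `x` has cardinality less than `θ`. -/
def HMemE (x θ : M) : Prop :=
  ∃ t, TransE E t ∧ SubE E x t ∧ ∃ β f, E β θ ∧ SurjE E f β t

/-- `f` is (the graph of) the cumulative-hierarchy sequence `⟨V_β | β < α⟩`,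
determined by the recursion `V_β = {z | ∃ γ < β, z ⊆ V_γ}`. -/
def VHierE (f α : M) : Prop :=
  OrdE E α ∧ ∀ β, E β α →
    (∃ w, PairMemE E f β w ∧
      ∀ z, E z w ↔ ∃ γ, E γ β ∧ ∃ u, PairMemE E f γ u ∧ SubE E z u) ∧
    ∀ w w', PairMemE E f β w → PairMemE E f β w' → w = w'

/-- `x ∈ V_α`. -/
def VMemE (x α : M) : Prop :=
  OrdE E α ∧ ∃ f, VHierE E f α ∧ ∃ β u, E β α ∧ PairMemE E f β u ∧ SubE E x u

/-- The class `S` is a `Σₙ`-elementary subclass of the class `T`. -/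
def SigmaElemPairE (n : ℕ) (S T : M → Prop) : Prop :=
  (∀ x, S x → T x) ∧
    ∀ ⦃k : ℕ⦄ (φ : SetFormula k), IsSigma n φ → ∀ v : Fin k → M, (∀ i, S (v i)) →
      (RealizeIn E S φ v ↔ RealizeIn E T φ v)

/-- The class `S` is a (fully) elementary subclass of the class `T`. -/
def ElemPairE (S T : M → Prop) : Prop :=
  (∀ x, S x → T x) ∧
    ∀ ⦃k : ℕ⦄ (φ : SetFormula k) (v : Fin k → M), (∀ i, S (v i)) →
      (RealizeIn E S φ v ↔ RealizeIn E T φ v)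

/-- `j` is an elementary map from the class `S` into the class `T`. -/
def ElemMapE (S T : M → Prop) (j : M → M) : Prop :=
  (∀ x, S x → T (j x)) ∧
    ∀ ⦃k : ℕ⦄ (φ : SetFormula k) (v : Fin k → M), (∀ i, S (v i)) →
      (RealizeIn E S φ v ↔ RealizeIn E T φ fun i => j (v i))

/-- `α ∈ C⁽ⁿ⁾`: the ordinal `α` is `Σₙ`-correct, i.e. `V_α` is a `Σₙ`-elementary
submodel of the universe. -/
def CnE (n : ℕ) (α : M) : Prop :=
  OrdE E α ∧ SigmaElemPairE E n (fun x => VMemE E x α) fun _ => True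

/-- `κ` is a weakly shrewd cardinal. -/
def WeaklyShrewdE (κ : M) : Prop :=
  CardE E κ ∧ ∀ (φ : SetFormula 2) (θ z : M), CardE E θ → E κ θ → SubE E z κ →
    RealizeIn E (fun x => HMemE E x θ) φ ![z, κ] →
    ∃ κ' θ' z', CardE E κ' ∧ CardE E θ' ∧ E κ' θ' ∧ E κ' κ ∧
      InterSpecE E z' z κ' ∧ RealizeIn E (fun x => HMemE E x θ') φ ![z', κ']

/-- `κ` is a `C⁽ⁿ⁾`-weakly shrewd cardinal. -/
def CnWeaklyShrewdE (n : ℕ) (κ : M) : Prop :=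
  CardE E κ ∧ ∀ (φ : SetFormula 2) (θ z : M), CardE E θ → CnE E n θ → E κ θ →
    SubE E z κ → RealizeIn E (fun x => HMemE E x θ) φ ![z, κ] →
    ∃ κ' θ' z', CardE E κ' ∧ CardE E θ' ∧ CnE E n θ' ∧ E κ' θ' ∧ E κ' κ ∧
      InterSpecE E z' z κ' ∧ RealizeIn E (fun x => HMemE E x θ') φ ![z', κ']

/-- Axiom of extensionality for `(M, E)`. -/
def AxExtE : Prop := ∀ x y : M, (∀ z, E z x ↔ E z y) → x = y

/-- Axiom of pairing for `(M, E)`. -/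
def AxPairE : Prop := ∀ a b : M, ∃ p, UPairE E p a b

/-- Axiom of union for `(M, E)`. -/
def AxUnionE : Prop := ∀ a : M, ∃ u, ∀ z, E z u ↔ ∃ y, E y a ∧ E z y

/-- Axiom of power set for `(M, E)`. -/
def AxPowE : Prop := ∀ a : M, ∃ p, PowSpecE E p a

/-- Axiom of infinity for `(M, E)`. -/
def AxInfE : Prop :=
  ∃ I : M, (∃ e, E e I ∧ EmptyE E e) ∧ ∀ y, E y I → ∃ s, E s I ∧ SuccSpecE E s y

/-- Axiom of foundation for `(M, E)`. -/
def AxFoundE : Prop :=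
  ∀ a : M, (∃ z, E z a) → ∃ m, E m a ∧ ∀ z, E z a → ¬ E z m

/-- Separation scheme for `(M, E)`. -/
def AxSepE : Prop :=
  ∀ (k : ℕ) (φ : SetFormula (k + 1)) (p : Fin k → M) (a : M),
    ∃ s : M, ∀ z, E z s ↔ (E z a ∧ Realize E φ (Fin.cons z p))

/-- Replacement scheme for `(M, E)`. -/
def AxReplE : Prop :=
  ∀ (k : ℕ) (φ : SetFormula (k + 2)) (p : Fin k → M) (a : M),
    (∀ x, E x a → ∀ y y', Realize E φ (Fin.cons x (Fin.cons y p)) →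
      Realize E φ (Fin.cons x (Fin.cons y' p)) → y = y') →
    ∃ b : M, ∀ y, E y b ↔ ∃ x, E x a ∧ Realize E φ (Fin.cons x (Fin.cons y p))

/-- Axiom of choice for `(M, E)`. -/
def AxChoiceE : Prop :=
  ∀ a : M, (∀ x, E x a → ∃ z, E z x) →
    (∀ x y, E x a → E y a → x ≠ y → ¬ ∃ z, E z x ∧ E z y) →
    ∃ c, ∀ x, E x a → ∃ z, E z c ∧ E z x ∧ ∀ z', E z' c → E z' x → z' = z

/-- `(M, E)` is a model of `ZF⁻` (Zermelo–Fraenkel set theory without the power set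
axiom). -/
def IsZFMinusE : Prop :=
  AxExtE E ∧ AxPairE E ∧ AxUnionE E ∧ AxInfE E ∧ AxFoundE E ∧ AxSepE E ∧ AxReplE E

/-- `(M, E)` is a model of `ZFC`. -/
def IsZFCE : Prop :=
  Nonempty M ∧ IsZFMinusE E ∧ AxPowE E ∧ AxChoiceE E

/-- The set `m` is, with the induced membership relation, a transitive model
of `ZF⁻`. -/
def ZFMinusModelE (m : M) : Prop :=
  IsZFMinusE fun a b : {x : M // E x m} => E a.1 b.1

/-- `x` has cardinality `κ`. -/
def CardEqE (x κ : M) : Prop := ∃ f, BijE E f κ x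

/-- `m` is closed under sequences of length less than `κ`: `^{<κ}m ⊆ m`. -/
def SmallSeqClosedE (m κ : M) : Prop := ∀ γ f, E γ κ → IsFuncE E f γ m → E f m

/-- `κ` is a `C⁽ⁿ⁾`-strongly unfoldable cardinal. -/
def CnStronglyUnfoldableE (n : ℕ) (κ : M) : Prop :=
  InaccE E κ ∧ ∀ lam, CnE E n lam → E κ lam →
    ∀ m, TransE E m → ZFMinusModelE E m → CardEqE E m κ → E κ m →
      SmallSeqClosedE E m κ →
      ∃ N j κ', TransE E N ∧ (∀ x, VMemE E x lam → E x N) ∧ IsFuncE E j m N ∧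
        (∀ ⦃k : ℕ⦄ (φ : SetFormula k) (v w : Fin k → M), (∀ i, E (v i) m) →
          (∀ i, PairMemE E j (v i) (w i)) →
          (RealizeIn E (fun x => E x m) φ v ↔ RealizeIn E (fun x => E x N) φ w)) ∧
        (∀ α, E α κ → PairMemE E j α α) ∧ PairMemE E j κ κ' ∧ E lam κ' ∧
        SigmaElemPairE E n (fun x => VMemE E x lam) fun x => E x N ∧ VMemE E x κ'

/-- `x` is ordinal definable. -/
def IsODE (x : M) : Prop :=
  ∃ (k : ℕ) (φ : SetFormula (k + 1)) (p : Fin k → M), (∀ i, OrdE E (p i)) ∧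
    Realize E φ (Fin.cons x p) ∧ ∀ y, Realize E φ (Fin.cons y p) → y = x

/-- `x` is hereditarily ordinal definable, i.e. `x ∈ HOD`. -/
def IsHODE (x : M) : Prop := IsODE E x ∧ ∀ z, TCMemE E z x → IsODE E z

/-- The instance of the principle "`Ord` is essentially faint" for the class
sequence `⟨{A | Efam α A} | α ∈ Ord⟩`. -/
def FaintForE (Efam : M → M → Prop) : Prop :=
  (∀ α, OrdE E α → (∃ A, Efam α A) ∧ ∀ A, Efam α A → SubE E A α) →
    ∀ ξ, OrdE E ξ → ∃ α β A B, OrdE E α ∧ OrdE E β ∧ E ξ α ∧ E α β ∧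
      Efam β A ∧ InterSpecE E B A α ∧ Efam α B

/-- `C` is a closed unbounded class of ordinals. -/
def ClubClassE (C : M → Prop) : Prop :=
  (∀ x, C x → OrdE E x) ∧ (∀ α, OrdE E α → ∃ β, C β ∧ E α β) ∧
    ∀ l, OrdE E l → (∃ w, E w l) → (∀ α, E α l → ∃ β, C β ∧ E α β ∧ E β l) → C l

/-- The instance of the principle "`Ord` is essentially subtle" for the class
sequence `⟨{A | Efam α A} | α ∈ Ord⟩` and the class `C`. -/
def SubtleForE (Efam : M → M → Prop) (C : M → Prop) : Prop :=
  (∀ α, OrdE E α → (∃ A, Efam α A) ∧ ∀ A, Efam α A → SubE E A α) →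
    ClubClassE E C →
    ∃ α β A B, C α ∧ C β ∧ E α β ∧ Efam β A ∧ InterSpecE E B A α ∧ Efam α B

/-- The scheme "`Ord` is essentially faint" holds in `(M, E)`: every instance for a
definable (with parameters) class sequence holds. -/
def OrdFaintDefE : Prop :=
  ∀ (k : ℕ) (φ : SetFormula (k + 2)) (p : Fin k → M),
    FaintForE E fun α A => Realize E φ (Fin.cons α (Fin.cons A p))

/-- The scheme "`Ord` is essentially subtle" holds in `(M, E)`: every instance for
definable (with parameters) class sequences and club classes holds. -/
def OrdSubtleDefE : Prop :=
  ∀ (k k' : ℕ) (φ : SetFormula (k + 2)) (p : Fin k → M)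
    (ψ : SetFormula (k' + 1)) (q : Fin k' → M),
    SubtleForE E (fun α A => Realize E φ (Fin.cons α (Fin.cons A p)))
      fun x => Realize E ψ (Fin.cons x q)

/-- There is a proper class of subtle cardinals in `(M, E)`. -/
def ProperClassSubtleE : Prop := ∀ α, OrdE E α → ∃ κ, SubtleE E κ ∧ E α κ

/-- There are no strongly inaccessible cardinals in `(M, E)`. -/
def NoInaccE : Prop := ∀ κ, ¬ InaccE E κ

end Generic

end Paper


namespace Paper

/-! ### Renaming and definability -/

def SetFormula.rename : ∀ {n m : ℕ}, (Fin n → Fin m) → SetFormula n → SetFormula m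
  | _, _, f, .mem i j => .mem (f i) (f j)
  | _, _, f, .eq i j => .eq (f i) (f j)
  | _, _, _, .fal => .fal
  | _, _, f, .imp φ ψ => .imp (φ.rename f) (ψ.rename f)
  | _, m, f, .all φ =>
      .all (φ.rename (Fin.lastCases (Fin.last m) (fun i => (f i).castSucc)))

theorem realize_rename {M : Type*} (E : M → M → Prop) {n : ℕ} (φ : SetFormula n) :
    ∀ {m : ℕ} (f : Fin n → Fin m) (v : Fin m → M),
      Realize E (φ.rename f) v ↔ Realize E φ (fun i => v (f i)) := by
  induction φ with
  | mem i j => intros; rfl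
  | eq i j => intros; rfl
  | fal => intros; rfl
  | imp φ ψ ih1 ih2 =>
    intro m f v
    simp only [SetFormula.rename, Realize, ih1, ih2]
  | all φ ih =>
    intro m f v
    simp only [SetFormula.rename, Realize, ih]
    refine forall_congr' fun a => iff_of_eq (congrArg _ ?_)
    funext i
    refine Fin.lastCases ?_ (fun i => ?_) i <;> simp

section Dfn

variable {J : Type*} {M : J → Type} (E : ∀ j, M j → M j → Prop)

def tv (t : ℕ ⊕ (∀ j, M j)) (j : J) (v : ℕ → M j) : M j :=
  match t with
  | .inl i => v i
  | .inr c => c j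

class IsTm (t : ∀ j, (ℕ → M j) → M j) : Prop where
  out : ∃ s : ℕ ⊕ (∀ j, M j), ∀ j v, t j v = tv s j v

instance isTm_var (i : ℕ) : IsTm (M := M) (fun _ v => v i) := ⟨.inl i, fun _ _ => rfl⟩
instance isTm_const (c : ∀ j, M j) : IsTm (M := M) (fun j _ => c j) := ⟨.inr c, fun _ _ => rfl⟩

instance isTm_shift (t : ∀ j, (ℕ → M j) → M j) [ht : IsTm t] (f : ℕ → ℕ) :
    IsTm (M := M) (fun j v => t j (fun i => v (f i))) := by
  obtain ⟨s, hs⟩ := ht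
  rcases s with k | c
  · exact ⟨.inl (f k), fun j v => by rw [hs]; rfl⟩
  · exact ⟨.inr c, fun j v => by rw [hs]; rfl⟩

class Dfn (P : ∀ j, (ℕ → M j) → Prop) : Prop where
  out : ∃ (n : ℕ) (φ : SetFormula n) (t : Fin n → ℕ ⊕ (∀ j, M j)),
    ∀ j v, P j v ↔ Realize (E j) φ (fun i => tv (t i) j v)

instance dfn_realize {n : ℕ} (φ : SetFormula n) (t : Fin n → ∀ j, (ℕ → M j) → M j)
    [h : ∀ i, IsTm (t i)] : Dfn E (fun j v => Realize (E j) φ (fun i => t i j v)) := by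
  choose s hs using fun i => (h i).out
  exact ⟨n, φ, s, fun j v => by simp only [hs]⟩

instance dfn_mem (t s : ∀ j, (ℕ → M j) → M j) [ht : IsTm t] [hs : IsTm s] :
    Dfn E (fun j v => E j (t j v) (s j v)) := by
  obtain ⟨a, ha⟩ := ht
  obtain ⟨b, hb⟩ := hs
  exact ⟨2, .mem 0 1, ![a, b], fun j v => by simp [Realize, ha, hb]⟩

instance dfn_eq (t s : ∀ j, (ℕ → M j) → M j) [ht : IsTm t] [hs : IsTm s] :
    Dfn E (fun j v => t j v = s j v) := by
  obtain ⟨a, ha⟩ := ht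
  obtain ⟨b, hb⟩ := hs
  exact ⟨2, .eq 0 1, ![a, b], fun j v => by simp [Realize, ha, hb]⟩

instance dfn_false : Dfn E (fun _ _ => False) := ⟨0, .fal, Fin.elim0, fun _ _ => Iff.rfl⟩

instance dfn_imp (P Q : ∀ j, (ℕ → M j) → Prop) [hP : Dfn E P] [hQ : Dfn E Q] :
    Dfn E (fun j v => P j v → Q j v) := by
  obtain ⟨n, φ, t, h1⟩ := hP
  obtain ⟨m, ψ, s, h2⟩ := hQ
  refine ⟨n + m, .imp (φ.rename (Fin.castAdd m)) (ψ.rename (Fin.natAdd n)), Fin.append t s, ?_⟩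
  intro j v
  simp only [Realize, realize_rename, h1, h2, Fin.append_left, Fin.append_right]

variable {E} in
theorem Dfn.congr {P Q : ∀ j, (ℕ → M j) → Prop} (hP : Dfn E P) (h : ∀ j v, P j v ↔ Q j v) :
    Dfn E Q := by
  obtain ⟨n, φ, t, h1⟩ := hP
  exact ⟨n, φ, t, fun j v => (h j v).symm.trans (h1 j v)⟩

instance dfn_not (P : ∀ j, (ℕ → M j) → Prop) [hP : Dfn E P] : Dfn E (fun j v => ¬ P j v) :=
  (dfn_imp E P (fun _ _ => False)).congr fun _ _ => Iff.rfl

instance dfn_and (P Q : ∀ j, (ℕ → M j) → Prop) [hP : Dfn E P] [hQ : Dfn E Q] :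
    Dfn E (fun j v => P j v ∧ Q j v) :=
  (dfn_not E (fun j v => P j v → ¬ Q j v)).congr fun _ _ => by tauto

instance dfn_or (P Q : ∀ j, (ℕ → M j) → Prop) [hP : Dfn E P] [hQ : Dfn E Q] :
    Dfn E (fun j v => P j v ∨ Q j v) :=
  (dfn_imp E (fun j v => ¬ P j v) Q).congr fun _ _ => by tauto

instance dfn_iff (P Q : ∀ j, (ℕ → M j) → Prop) [hP : Dfn E P] [hQ : Dfn E Q] :
    Dfn E (fun j v => P j v ↔ Q j v) :=
  (dfn_and E (fun j v => P j v → Q j v) (fun j v => Q j v → P j v)).congr fun _ _ => by tauto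

def scons {α : Type*} (a : α) (v : ℕ → α) : ℕ → α
  | 0 => a
  | n + 1 => v n

instance dfn_all (Q : ∀ j, (ℕ → M j) → M j → Prop)
    [h : Dfn E (fun j w => Q j (fun i => w (i + 1)) (w 0))] :
    Dfn E (fun j v => ∀ a : M j, Q j v a) := by
  obtain ⟨n, φ, t, h⟩ := h
  let f : Fin n → Fin (n + 1) := fun i => match t i with
    | .inl 0 => Fin.last n
    | _ => i.castSucc
  let s : Fin n → ℕ ⊕ (∀ j, M j) := fun i => match t i with
    | .inl 0 => .inl 0
    | .inl (k + 1) => .inl k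
    | .inr c => .inr c
  refine ⟨n, .all (φ.rename f), s, fun j v => ?_⟩
  simp only [Realize, realize_rename]
  refine forall_congr' fun a => ?_
  have := h j (scons a v)
  simp only [scons] at this
  rw [this]
  refine iff_of_eq (congrArg _ ?_)
  funext i
  simp only [f, s]
  rcases hti : t i with (_ | k) | c <;> simp [tv, scons, hti]

instance dfn_ex (Q : ∀ j, (ℕ → M j) → M j → Prop)
    [h : Dfn E (fun j w => Q j (fun i => w (i + 1)) (w 0))] :
    Dfn E (fun j v => ∃ a : M j, Q j v a) :=
  (dfn_not E (fun j v => ∀ a, ¬ Q j v a)).congr fun _ _ => by simp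

instance dfn_Trans (t1 : ∀ j, (ℕ → M j) → M j) [IsTm t1] :
    Dfn E (fun j v => TransE (E j) (t1 j v)) := by
  unfold TransE; infer_instance

instance dfn_Ord (t1 : ∀ j, (ℕ → M j) → M j) [IsTm t1] :
    Dfn E (fun j v => OrdE (E j) (t1 j v)) := by
  unfold OrdE; infer_instance

instance dfn_Sub (t1 t2 : ∀ j, (ℕ → M j) → M j) [IsTm t1] [IsTm t2] :
    Dfn E (fun j v => SubE (E j) (t1 j v) (t2 j v)) := by
  unfold SubE; infer_instance

instance dfn_Le (t1 t2 : ∀ j, (ℕ → M j) → M j) [IsTm t1] [IsTm t2] :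
    Dfn E (fun j v => LeE (E j) (t1 j v) (t2 j v)) := by
  unfold LeE; infer_instance

instance dfn_Empty (t1 : ∀ j, (ℕ → M j) → M j) [IsTm t1] :
    Dfn E (fun j v => EmptyE (E j) (t1 j v)) := by
  unfold EmptyE; infer_instance

instance dfn_SuccSpec (t1 t2 : ∀ j, (ℕ → M j) → M j) [IsTm t1] [IsTm t2] :
    Dfn E (fun j v => SuccSpecE (E j) (t1 j v) (t2 j v)) := by
  unfold SuccSpecE; infer_instance

instance dfn_Limit (t1 : ∀ j, (ℕ → M j) → M j) [IsTm t1] :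
    Dfn E (fun j v => LimitE (E j) (t1 j v)) := by
  unfold LimitE; infer_instance

instance dfn_UPair (t1 t2 t3 : ∀ j, (ℕ → M j) → M j) [IsTm t1] [IsTm t2] [IsTm t3] :
    Dfn E (fun j v => UPairE (E j) (t1 j v) (t2 j v) (t3 j v)) := by
  unfold UPairE; infer_instance

instance dfn_OPair (t1 t2 t3 : ∀ j, (ℕ → M j) → M j) [IsTm t1] [IsTm t2] [IsTm t3] :
    Dfn E (fun j v => OPairE (E j) (t1 j v) (t2 j v) (t3 j v)) := by
  unfold OPairE; infer_instance

instance dfn_PairMem (t1 t2 t3 : ∀ j, (ℕ → M j) → M j) [IsTm t1] [IsTm t2] [IsTm t3] :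
    Dfn E (fun j v => PairMemE (E j) (t1 j v) (t2 j v) (t3 j v)) := by
  unfold PairMemE; infer_instance

instance dfn_InterSpec (t1 t2 t3 : ∀ j, (ℕ → M j) → M j) [IsTm t1] [IsTm t2] [IsTm t3] :
    Dfn E (fun j v => InterSpecE (E j) (t1 j v) (t2 j v) (t3 j v)) := by
  unfold InterSpecE; infer_instance

end Dfn
end Paper

namespace Paper

/-! ### Working inside a model of ZF -/

section ZF

variable {M : Type} (E : M → M → Prop)

/-- Definable (with parameters) unary predicate. -/
abbrev D1 (P : M → Prop) : Prop :=
  ∀ (t : Unit → (ℕ → M) → M) [IsTm (J := Unit) (M := fun _ => M) t],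
    Dfn (J := Unit) (M := fun _ => M) (fun _ => E) (fun j v => P (t j v))

/-- Definable (with parameters) binary predicate. -/
abbrev D2 (P : M → M → Prop) : Prop :=
  ∀ (t s : Unit → (ℕ → M) → M) [IsTm (J := Unit) (M := fun _ => M) t]
    [IsTm (J := Unit) (M := fun _ => M) s],
    Dfn (J := Unit) (M := fun _ => M) (fun _ => E) (fun j v => P (t j v) (s j v))

theorem extract2 (R : M → M → Prop) (hR : D2 E R) (d : M) :
    ∃ (k : ℕ) (φ : SetFormula (k + 2)) (p : Fin k → M),
      ∀ x y, R x y ↔ Realize E φ (Fin.cons x (Fin.cons y p)) := by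
  obtain ⟨n, φ, t, h⟩ := hR (fun _ v => v 0) (fun _ v => v 1)
  let f : Fin n → Fin (n + 2) := fun i => match t i with
    | .inl 0 => 0
    | .inl (_ + 1) => 1
    | .inr _ => i.succ.succ
  let p : Fin n → M := fun i => match t i with
    | .inl _ => d
    | .inr c => c ()
  refine ⟨n, φ.rename f, p, fun x y => ?_⟩
  rw [realize_rename]
  have := h () (fun i => match i with | 0 => x | _ + 1 => y)
  simp only at this
  rw [this]
  refine iff_of_eq (congrArg _ ?_)
  funext i
  simp only [f, p]
  rcases hti : t i with (_ | k) | c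
  · simp [tv]
  · simp only [tv]
    exact (Fin.cons_succ (α := fun _ => M) x (Fin.cons y p) 0).symm ▸ rfl
  · simp [tv, hti]

structure ZF : Prop where
  ext : ∀ x y : M, (∀ z, E z x ↔ E z y) → x = y
  pair : AxPairE E
  union : AxUnionE E
  pow : AxPowE E
  inf : AxInfE E
  found : AxFoundE E
  sep : ∀ (P : M → Prop) (_ : D1 E P) (a : M), ∃ s, ∀ z, E z s ↔ (E z a ∧ P z)
  repl : ∀ (R : M → M → Prop) (_ : D2 E R) (a : M),
    (∀ x, E x a → ∀ y y', R x y → R x y' → y = y') → ∃ b, ∀ y, E y b ↔ ∃ x, E x a ∧ R x y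

variable {E}

theorem zf_of_zfc (h : IsZFCE E) : ZF E := by
  obtain ⟨⟨d⟩, ⟨h1, h2, h3, h4, h5, h6, h7⟩, h8, -⟩ := h
  refine ⟨h1, h2, h3, h8, h4, h5, ?_, ?_⟩
  · intro P hP a
    obtain ⟨k, φ, p, hφ⟩ := extract2 E (fun x _ => P x) (fun t s _ _ => inferInstance) d
    obtain ⟨s, hs⟩ := h6 (k + 1) φ (Fin.cons d p) a
    exact ⟨s, fun z => by rw [hs, hφ z d]⟩
  · intro R hR a hf
    obtain ⟨k, φ, p, hφ⟩ := extract2 E R hR d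
    simp only [hφ] at hf ⊢
    exact h7 k φ p a hf

namespace ZF


theorem irrefl (Z : ZF E) (x : M) : ¬ E x x := by
  intro h
  obtain ⟨p, hp⟩ := Z.pair x x
  obtain ⟨m, hm, hm'⟩ := Z.found p ⟨x, (hp x).2 (.inl rfl)⟩
  rcases (hp m).1 hm with rfl | rfl <;> exact hm' _ hm h

theorem asymm (Z : ZF E) (x y : M) (h : E x y) : ¬ E y x := by
  intro h'
  obtain ⟨p, hp⟩ := Z.pair x y
  obtain ⟨m, hm, hm'⟩ := Z.found p ⟨x, (hp x).2 (.inl rfl)⟩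
  rcases (hp m).1 hm with rfl | rfl
  · exact hm' y ((hp y).2 (.inr rfl)) h'
  · exact hm' x ((hp x).2 (.inl rfl)) h

theorem upair_unique (Z : ZF E) {p q a b : M} (h : UPairE E p a b) (h' : UPairE E q a b) : p = q :=
  Z.ext _ _ fun z => (h z).trans (h' z).symm

theorem opair_ex (Z : ZF E) (a b : M) : ∃ p, OPairE E p a b := by
  obtain ⟨s, hs⟩ := Z.pair a a
  obtain ⟨t, ht⟩ := Z.pair a b
  obtain ⟨p, hp⟩ := Z.pair s t
  exact ⟨p, s, t, hs, ht, hp⟩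

theorem opair_unique (Z : ZF E) {p q a b : M} (h : OPairE E p a b) (h' : OPairE E q a b) : p = q := by
  obtain ⟨s, t, h1, h2, h3⟩ := h
  obtain ⟨s', t', h1', h2', h3'⟩ := h'
  obtain rfl := Z.upair_unique h1 h1'
  obtain rfl := Z.upair_unique h2 h2'
  exact Z.upair_unique h3 h3'

theorem upair_inj (Z : ZF E) {p a b c d : M} (h : UPairE E p a b) (h' : UPairE E p c d) :
    (a = c ∧ b = d) ∨ (a = d ∧ b = c) := by
  have h1 := (h' a).1 ((h a).2 (.inl rfl))
  have h2 := (h' b).1 ((h b).2 (.inr rfl))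
  have h3 := (h c).1 ((h' c).2 (.inl rfl))
  have h4 := (h d).1 ((h' d).2 (.inr rfl))
  grind

theorem opair_inj (Z : ZF E) {p a b c d : M} (h : OPairE E p a b) (h' : OPairE E p c d) :
    a = c ∧ b = d := by
  obtain ⟨s, t, h1, h2, h3⟩ := h
  obtain ⟨s', t', h1', h2', h3'⟩ := h'
  rcases Z.upair_inj h3 h3' with ⟨rfl, rfl⟩ | ⟨rfl, rfl⟩
  · have := Z.upair_inj h1 h1'
    have := Z.upair_inj h2 h2'
    grind
  · have := Z.upair_inj h1 h2'
    have := Z.upair_inj h2 h1'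
    grind

/-- `e ∪ {w}` exists. -/
theorem insert_ex (Z : ZF E) (e w : M) : ∃ s, ∀ z, E z s ↔ (E z e ∨ z = w) := by
  obtain ⟨q, hq⟩ := Z.pair w w
  obtain ⟨p, hp⟩ := Z.pair e q
  obtain ⟨u, hu⟩ := Z.union p
  refine ⟨u, fun z => ?_⟩
  rw [hu]
  constructor
  · rintro ⟨y, hy, hz⟩
    rcases (hp y).1 hy with rfl | rfl
    · exact .inl hz
    · exact .inr (by simpa using (hq z).1 hz)
  · rintro (h | rfl)
    · exact ⟨e, (hp e).2 (.inl rfl), h⟩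
    · exact ⟨q, (hp q).2 (.inr rfl), (hq _).2 (.inl rfl)⟩

theorem empty_ex (Z : ZF E) : ∃ e, EmptyE E e := by
  obtain ⟨I, ⟨e, _, he⟩, _⟩ := Z.inf
  exact ⟨e, he⟩

theorem finite_ex (Z : ZF E) (s : Set M) (hs : s.Finite) : ∃ m, ∀ z, E z m ↔ z ∈ s := by
  induction s, hs using Set.Finite.induction_on with
  | empty =>
    obtain ⟨e, he⟩ := Z.empty_ex
    exact ⟨e, fun z => by simpa using he z⟩
  | @insert a s _ _ ih =>
    obtain ⟨m, hm⟩ := ih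
    obtain ⟨m', hm'⟩ := Z.insert_ex m a
    exact ⟨m', fun z => by rw [hm', hm, Set.mem_insert_iff, or_comm]⟩

theorem infinite (Z : ZF E) : Infinite M := by
  by_contra h
  rw [not_infinite_iff_finite] at h
  obtain ⟨m, hm⟩ := Z.finite_ex Set.univ Set.finite_univ
  exact Z.irrefl m ((hm m).2 trivial)

theorem succ_inj (Z : ZF E) {m a b : M} (h : SuccSpecE E m a) (h' : SuccSpecE E m b) : a = b := by
  have h1 := (h' a).1 ((h a).2 (.inr rfl))
  have h2 := (h b).1 ((h' b).2 (.inr rfl))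
  have := Z.asymm a b
  grind

/-- Closure of a set under a definable partial function. -/
theorem iterate (Z : ZF E) (G : M → M → Prop) [hG : D2 E G] (x0 : M)
    (hf : ∀ x y y', G x y → G x y' → y = y') :
    ∃ J, E x0 J ∧ ∀ y z, E y J → G y z → E z J := by
  obtain ⟨I, ⟨e, heI, he⟩, hI⟩ := Z.inf
  let R : M → M → Prop := fun n y => ∃ f, PairMemE E f n y ∧ ∀ m z, PairMemE E f m z →
    E m I ∧ ((EmptyE E m ∧ z = x0) ∨ ∃ m' z', PairMemE E f m' z' ∧ SuccSpecE E m m' ∧ G z' z)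
  have hR : D2 E R := fun t s _ _ => inferInstance
  have hfun : ∀ x, E x I → ∀ y y', R x y → R x y' → y = y' := by
    by_contra hcon
    push Not at hcon
    obtain ⟨x, hx, y, y', h1, h2, h3⟩ := hcon
    obtain ⟨S, hS⟩ := Z.sep (fun n => ∃ y y', R n y ∧ R n y' ∧ ¬ y = y') (fun t _ => inferInstance) I
    obtain ⟨m, hm, hmin⟩ := Z.found S ⟨x, (hS x).2 ⟨hx, y, y', h1, h2, h3⟩⟩
    obtain ⟨hmI, y, y', ⟨f, hf1, hf2⟩, ⟨f', hf1', hf2'⟩, hne⟩ := (hS m).1 hm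
    rcases (hf2 m y hf1).2 with ⟨ha, hb⟩ | ⟨m1, z1, ha, hb, hc⟩ <;>
    rcases (hf2' m y' hf1').2 with ⟨ha', hb'⟩ | ⟨m1', z1', ha', hb', hc'⟩
    · exact hne (hb.trans hb'.symm)
    · exact ha m1' ((hb' _).2 (.inr rfl))
    · exact ha' m1 ((hb _).2 (.inr rfl))
    · obtain rfl := Z.succ_inj hb hb'
      refine hmin m1 ((hS m1).2 ⟨(hf2 _ _ ha).1, z1, z1', ⟨f, ha, hf2⟩, ⟨f', ha', hf2'⟩, ?_⟩)
        ((hb _).2 (.inr rfl))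
      rintro rfl
      exact hne (hf _ _ _ hc hc')
  obtain ⟨J, hJ⟩ := Z.repl R hR I hfun
  refine ⟨J, (hJ _).2 ⟨e, heI, ?_⟩, ?_⟩
  · obtain ⟨p, hp⟩ := Z.opair_ex e x0
    obtain ⟨f, hf⟩ := Z.pair p p
    refine ⟨f, ⟨p, (hf p).2 (.inl rfl), hp⟩, ?_⟩
    rintro m z ⟨q, hq, hq'⟩
    obtain rfl : q = p := by simpa using (hf q).1 hq
    obtain ⟨rfl, rfl⟩ := Z.opair_inj hp hq'
    exact ⟨heI, .inl ⟨he, rfl⟩⟩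
  · intro y z hy hyz
    obtain ⟨n, hn, f, hf1, hf2⟩ := (hJ y).1 hy
    obtain ⟨n', hn', hs⟩ := hI n hn
    obtain ⟨p, hp⟩ := Z.opair_ex n' z
    obtain ⟨f', hf'⟩ := Z.insert_ex f p
    refine (hJ z).2 ⟨n', hn', f', ⟨p, (hf' p).2 (.inr rfl), hp⟩, ?_⟩
    have hmono : ∀ a b, PairMemE E f a b → PairMemE E f' a b := by
      rintro a b ⟨q, hq, hq'⟩
      exact ⟨q, (hf' q).2 (.inl hq), hq'⟩
    rintro a b ⟨q, hq, hq'⟩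
    rcases (hf' q).1 hq with h | rfl
    · obtain ⟨h1, h2⟩ := hf2 a b ⟨q, h, hq'⟩
      refine ⟨h1, h2.imp id ?_⟩
      rintro ⟨m', z', h3, h4, h5⟩
      exact ⟨m', z', hmono _ _ h3, h4, h5⟩
    · obtain ⟨rfl, rfl⟩ := Z.opair_inj hp hq'
      exact ⟨hn', .inr ⟨n, y, hmono _ _ hf1, hs, hyz⟩⟩

theorem tc_ex (Z : ZF E) (x : M) : ∃ t, TransE E t ∧ E x t := by
  obtain ⟨J, hx, hJ⟩ := Z.iterate (fun y z => ∀ w, E w z ↔ ∃ u, E u y ∧ E w u)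
    (hG := fun t s _ _ => inferInstance) x
    (fun a y y' h h' => Z.ext _ _ fun z => (h z).trans (h' z).symm)
  obtain ⟨u, hu⟩ := Z.union J
  obtain ⟨t, ht⟩ := Z.insert_ex u x
  refine ⟨t, ?_, (ht x).2 (.inr rfl)⟩
  intro y hy z hz
  rw [ht, hu]
  rcases (ht y).1 hy with h | rfl
  · obtain ⟨w, hw, hyw⟩ := (hu y).1 h
    obtain ⟨w', hw'⟩ := Z.union w
    exact .inl ⟨w', hJ w w' hw hw', (hw' z).2 ⟨y, hyw, hz⟩⟩
  · exact .inl ⟨y, hx, hz⟩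

/-- Foundation for definable classes. -/
theorem min_ex (Z : ZF E) (P : M → Prop) [hP : D1 E P] (x : M) (hx : P x) :
    ∃ m, P m ∧ ∀ z, E z m → ¬ P z := by
  obtain ⟨t, ht, hxt⟩ := Z.tc_ex x
  obtain ⟨s, hs⟩ := Z.sep P hP t
  obtain ⟨m, hm, hmin⟩ := Z.found s ⟨x, (hs x).2 ⟨hxt, hx⟩⟩
  obtain ⟨h1, h2⟩ := (hs m).1 hm
  exact ⟨m, h2, fun z hz hPz => hmin z ((hs z).2 ⟨ht m h1 z hz, hPz⟩) hz⟩

theorem mem_ind (Z : ZF E) (P : M → Prop) [hP : D1 E P] (h : ∀ x, (∀ y, E y x → P y) → P x) (x : M) :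
    P x := by
  by_contra hx
  obtain ⟨m, hm, hmin⟩ := Z.min_ex (fun z => ¬ P z) (hP := fun t _ => inferInstance) x hx
  exact hm (h m fun y hy => not_not.1 (hmin y hy))

/-! Ordinals -/

theorem ord_mem {a b : M} (ha : OrdE E a) (hb : E b a) : OrdE E b :=
  ⟨ha.2 b hb, fun y hy => ha.2 y (ha.1 b hb y hy)⟩

theorem ord_cmp (Z : ZF E) (a b : M) (ha : OrdE E a) (hb : OrdE E b) : E a b ∨ a = b ∨ E b a := by
  by_contra hcon
  obtain ⟨a, ⟨ha, b, hb, hab⟩, hmin⟩ := Z.min_ex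
    (fun a => OrdE E a ∧ ∃ b, OrdE E b ∧ ¬ (E a b ∨ a = b ∨ E b a))
    (hP := fun t _ => inferInstance) a ⟨ha, b, hb, hcon⟩
  obtain ⟨b, ⟨hb, hab⟩, hmin'⟩ := Z.min_ex
    (fun b => OrdE E b ∧ ¬ (E a b ∨ a = b ∨ E b a))
    (hP := fun t _ => inferInstance) b ⟨hb, hab⟩
  refine hab (.inr (.inl (Z.ext _ _ fun z => ⟨fun hz => ?_, fun hz => ?_⟩)))
  · have h1 := hmin z hz
    have : E z b ∨ z = b ∨ E b z := by
      by_contra h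
      exact h1 ⟨ord_mem ha hz, b, hb, h⟩
    rcases this with h | rfl | h
    · exact h
    · exact absurd (.inr (.inr hz)) hab
    · exact absurd (.inr (.inr (ha.1 z hz b h))) hab
  · have h1 := hmin' z hz
    have : E a z ∨ a = z ∨ E z a := by
      by_contra h
      exact h1 ⟨ord_mem hb hz, h⟩
    rcases this with h | rfl | h
    · exact absurd (.inl (hb.1 z hz a h)) hab
    · exact absurd (.inl hz) hab
    · exact h

end ZF

/-! Levels of the cumulative hierarchy -/

def HistE {M : Type} (E : M → M → Prop) (h : M) : Prop :=
  ∀ u, E u h → ∀ x, E x u ↔ ∃ w, E w h ∧ E w u ∧ SubE E x w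

def LevE {M : Type} (E : M → M → Prop) (v : M) : Prop :=
  ∃ h, HistE E h ∧ ∀ x, E x v ↔ ∃ w, E w h ∧ SubE E x w

end ZF

instance dfn_Hist {J : Type*} {M : J → Type} (E : ∀ j, M j → M j → Prop)
    (t1 : ∀ j, (ℕ → M j) → M j) [IsTm t1] :
    Dfn E (fun j v => HistE (E j) (t1 j v)) := by
  unfold HistE; infer_instance

instance dfn_Lev {J : Type*} {M : J → Type} (E : ∀ j, M j → M j → Prop)
    (t1 : ∀ j, (ℕ → M j) → M j) [IsTm t1] :
    Dfn E (fun j v => LevE (E j) (t1 j v)) := by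
  unfold LevE; infer_instance

namespace ZF

variable {M : Type} {E : M → M → Prop}

theorem lev_potent {v x y : M} (hv : LevE E v) (hy : E y v) (hx : SubE E x y) : E x v := by
  obtain ⟨h, _, hv⟩ := hv
  obtain ⟨w, hw, hyw⟩ := (hv y).1 hy
  exact (hv x).2 ⟨w, hw, fun z hz => hyw z (hx z hz)⟩


theorem hist_trans (Z : ZF E) {h w : M} (hh : HistE E h) (hw : E w h) : TransE E w := by
  by_contra hcon
  obtain ⟨w, ⟨hw, hcon⟩, hmin⟩ := Z.min_ex (fun w => E w h ∧ ¬ TransE E w)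
    (hP := fun t _ => inferInstance) w ⟨hw, hcon⟩
  apply hcon
  intro u hu z hz
  obtain ⟨w', h1, h2, h3⟩ := (hh w hw u).1 hu
  have ht : TransE E w' := by
    by_contra h
    exact hmin w' h2 ⟨h1, h⟩
  exact (hh w hw z).2 ⟨w', h1, h2, fun y hy => ht z (h3 z hz) y hy⟩

theorem lev_trans (Z : ZF E) {v : M} (hv : LevE E v) : TransE E v := by
  obtain ⟨h, hh, hv⟩ := hv
  intro y hy z hz
  obtain ⟨w, hw, hyw⟩ := (hv y).1 hy
  exact (hv z).2 ⟨w, hw, Z.hist_trans hh hw z (hyw z hz)⟩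

theorem hist_lev (Z : ZF E) {h w : M} (hh : HistE E h) (hw : E w h) : LevE E w := by
  obtain ⟨h', hh'⟩ := Z.sep (fun z => E z w) (fun t _ => inferInstance) h
  have ht := Z.hist_trans hh hw
  refine ⟨h', ?_, ?_⟩
  · intro u hu x
    obtain ⟨h1, h2⟩ := (hh' u).1 hu
    rw [hh u h1 x]
    constructor
    · rintro ⟨r, h3, h4, h5⟩
      exact ⟨r, (hh' r).2 ⟨h3, ht u h2 r h4⟩, h4, h5⟩
    · rintro ⟨r, h3, h4, h5⟩
      exact ⟨r, ((hh' r).1 h3).1, h4, h5⟩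
  · intro x
    rw [hh w hw x]
    simp only [hh', and_assoc]

theorem lev_acc (Z : ZF E) {s : M} (hs : LevE E s) (x : M) :
    E x s ↔ ∃ r, E r s ∧ LevE E r ∧ SubE E x r := by
  constructor
  · obtain ⟨h, hh, hv⟩ := hs
    intro hx
    obtain ⟨w, hw, hxw⟩ := (hv x).1 hx
    exact ⟨w, (hv w).2 ⟨w, hw, fun _ h => h⟩, Z.hist_lev hh hw, hxw⟩
  · rintro ⟨r, h1, _, h2⟩
    exact lev_potent hs h1 h2

theorem lev_cmp (Z : ZF E) (a b : M) (ha : LevE E a) (hb : LevE E b) : E a b ∨ a = b ∨ E b a := by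
  by_contra hcon
  obtain ⟨a, ⟨ha, b, hb, hab⟩, hmin⟩ := Z.min_ex
    (fun a => LevE E a ∧ ∃ b, LevE E b ∧ ¬ (E a b ∨ a = b ∨ E b a))
    (hP := fun t _ => inferInstance) a ⟨ha, b, hb, hcon⟩
  obtain ⟨b, ⟨hb, hab⟩, hmin'⟩ := Z.min_ex
    (fun b => LevE E b ∧ ¬ (E a b ∨ a = b ∨ E b a))
    (hP := fun t _ => inferInstance) b ⟨hb, hab⟩
  have key : ∀ z, LevE E z → (E z a ↔ E z b) := by
    intro z hzl
    constructor <;> intro hz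
    · have h1 := hmin z hz
      have : E z b ∨ z = b ∨ E b z := by
        by_contra h
        exact h1 ⟨hzl, b, hb, h⟩
      rcases this with h | rfl | h
      · exact h
      · exact absurd (.inr (.inr hz)) hab
      · exact absurd (.inr (.inr (Z.lev_trans ha z hz b h))) hab
    · have h1 := hmin' z hz
      have : E a z ∨ a = z ∨ E z a := by
        by_contra h
        exact h1 ⟨hzl, h⟩
      rcases this with h | rfl | h
      · exact absurd (.inl (Z.lev_trans hb z hz a h)) hab
      · exact absurd (.inl hz) hab
      · exact h
  refine hab (.inr (.inl (Z.ext _ _ fun z => ?_)))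
  rw [Z.lev_acc ha, Z.lev_acc hb]
  exact exists_congr fun r => ⟨fun ⟨h1, h2, h3⟩ => ⟨(key r h2).1 h1, h2, h3⟩,
    fun ⟨h1, h2, h3⟩ => ⟨(key r h2).2 h1, h2, h3⟩⟩

/-- A downward closed set of levels is a history, and generates a level. -/
theorem lev_of_hist (Z : ZF E) {H : M} (hl : ∀ u, E u H → LevE E u)
    (hd : ∀ u, E u H → ∀ w, E w u → LevE E w → E w H) : HistE E H := by
  intro u hu x
  rw [Z.lev_acc (hl u hu)]
  constructor
  · rintro ⟨r, h1, h2, h3⟩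
    exact ⟨r, hd u hu r h1 h2, h1, h3⟩
  · rintro ⟨r, h1, h2, h3⟩
    exact ⟨r, h2, hl r h1, h3⟩

theorem lev_above (Z : ZF E) {h : M} (hl : ∀ u, E u h → LevE E u) :
    ∃ v, LevE E v ∧ ∀ u, E u h → E u v := by
  obtain ⟨U, hU⟩ := Z.union h
  obtain ⟨PU, hPU⟩ := Z.pow U
  obtain ⟨H, hH⟩ := Z.sep (fun z => LevE E z ∧ (E z h ∨ E z U)) (fun t _ => inferInstance) PU
  have hsub : ∀ u, E u h → SubE E u U := fun u hu z hz => (hU z).2 ⟨u, hu, hz⟩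
  have hH' : ∀ u, E u H ↔ LevE E u ∧ (E u h ∨ E u U) := by
    intro u
    rw [hH]
    refine ⟨fun h => h.2, fun hu => ⟨(hPU u).2 ?_, hu⟩⟩
    rcases hu.2 with h1 | h1
    · exact hsub u h1
    · obtain ⟨y, hy, hy'⟩ := (hU u).1 h1
      exact fun z hz => hsub y hy z (Z.lev_trans (hl y hy) u hy' z hz)
  have hHist : HistE E H := by
    refine Z.lev_of_hist (fun u hu => ((hH' u).1 hu).1) fun u hu w hw hwl => (hH' w).2 ⟨hwl, .inr ?_⟩
    rcases ((hH' u).1 hu).2 with h1 | h1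
    · exact hsub u h1 w hw
    · obtain ⟨y, hy, hy'⟩ := (hU u).1 h1
      exact hsub y hy w (Z.lev_trans (hl y hy) u hy' w hw)
  obtain ⟨v, hv⟩ := Z.sep (fun x => ∃ w, E w H ∧ SubE E x w) (fun t _ => inferInstance) PU
  have hv' : ∀ x, E x v ↔ ∃ w, E w H ∧ SubE E x w := by
    intro x
    rw [hv]
    refine ⟨fun h => h.2, fun hx => ⟨(hPU x).2 ?_, hx⟩⟩
    obtain ⟨w, hw, hxw⟩ := hx
    have := (hPU w).1 ((hH w).1 hw).1
    exact fun z hz => this z (hxw z hz)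
  exact ⟨v, ⟨H, hHist, hv'⟩, fun u hu =>
    (hv' u).2 ⟨u, (hH' u).2 ⟨hl u hu, .inl hu⟩, fun _ h => h⟩⟩

theorem lev_next (Z : ZF E) {u : M} (hu : LevE E u) : ∃ v, LevE E v ∧ E u v := by
  obtain ⟨p, hp⟩ := Z.pair u u
  obtain ⟨v, hv, h⟩ := Z.lev_above (h := p) (by
    intro w hw
    rcases (hp w).1 hw with rfl | rfl <;> exact hu)
  exact ⟨v, hv, h u ((hp u).2 (.inl rfl))⟩

theorem lev_min_unique (Z : ZF E) (P : M → Prop) {u v : M} (hu : LevE E u) (hv : LevE E v)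
    (hPu : P u) (hPv : P v) (hu' : ∀ w, E w u → LevE E w → ¬ P w)
    (hv' : ∀ w, E w v → LevE E w → ¬ P w) : u = v := by
  rcases Z.lev_cmp u v hu hv with h | h | h
  · exact absurd hPu (hv' u h hu)
  · exact h
  · exact absurd hPv (hu' v h hv)

/-- For a definable relation, bound witnesses in a level. -/
theorem lev_collect_aux (Z : ZF E) (Q : M → M → Prop) [hQ : D2 E Q] (y : M) :
    ∃ z, LevE E z ∧ ∀ e, E e y → (∃ x, Q e x ∧ LevE E x) → ∃ x, E x z ∧ Q e x ∧ LevE E x := by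
  obtain ⟨h, hh⟩ := Z.repl (fun e v => LevE E v ∧ Q e v ∧ ∀ w, E w v → LevE E w → ¬ Q e w)
    (fun t s _ _ => inferInstance) y (by
      intro e _ v v' h h'
      exact Z.lev_min_unique (Q e) h.1 h'.1 h.2.1 h'.2.1 h.2.2 h'.2.2)
  obtain ⟨z, hz, hz'⟩ := Z.lev_above (h := h) (by
    intro u hu
    obtain ⟨_, _, h, _⟩ := (hh u).1 hu
    exact h)
  refine ⟨z, hz, fun e he ⟨x, hx, hxl⟩ => ?_⟩
  obtain ⟨m, ⟨hm1, hm2⟩, hmin⟩ := Z.min_ex (fun x => Q e x ∧ LevE E x)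
    (hP := fun t _ => inferInstance) x ⟨hx, hxl⟩
  exact ⟨m, hz' m ((hh m).2 ⟨e, he, hm2, hm1, fun w hw hwl hq => hmin w hw ⟨hq, hwl⟩⟩), hm1, hm2⟩

theorem lev_ex (Z : ZF E) (x : M) : ∃ v, LevE E v ∧ E x v := by
  refine Z.mem_ind (fun x => ∃ v, LevE E v ∧ E x v) (hP := fun t _ => inferInstance) ?_ x
  intro x ih
  obtain ⟨z, hz, hz'⟩ := Z.lev_collect_aux (fun e v => E e v) (hQ := fun t s _ _ => inferInstance) x
  obtain ⟨v, hv, hzv⟩ := Z.lev_next hz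
  refine ⟨v, hv, lev_potent hv hzv fun y hy => ?_⟩
  obtain ⟨u, hu, hyu⟩ := ih y hy
  obtain ⟨w, hw, hyw, _⟩ := hz' y hy ⟨u, hyu, hu⟩
  exact Z.lev_trans hz w hw y hyw

theorem lev_collect (Z : ZF E) (Q : M → M → Prop) [hQ : D2 E Q] (y : M) :
    ∃ z, LevE E z ∧ ∀ e, E e y → (∃ x, Q e x) → ∃ x, E x z ∧ Q e x := by
  obtain ⟨z, hz, hz'⟩ := Z.lev_collect_aux (fun e v => ∃ x, E x v ∧ Q e x)
    (hQ := fun t s _ _ => inferInstance) y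
  refine ⟨z, hz, fun e he ⟨x, hx⟩ => ?_⟩
  obtain ⟨v, hv, hxv⟩ := Z.lev_ex x
  obtain ⟨w, hw, ⟨x', hx', hq⟩, _⟩ := hz' e he ⟨v, ⟨x, hxv, hx⟩, hv⟩
  exact ⟨x', Z.lev_trans hz w hw x' hx', hq⟩

/-- Limit levels closed under a definable relation. -/
theorem lev_closed (Z : ZF E) (G : M → M → Prop) [hG : D2 E G]
    (h : ∀ y, ∃ z, LevE E z ∧ E y z ∧ G y z) (x0 : M) :
    ∃ X, LevE E X ∧ E x0 X ∧ ∀ e, E e X → ∃ y z, LevE E y ∧ LevE E z ∧ E e y ∧ E y z ∧ E z X ∧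
      G y z := by
  obtain ⟨x1, hx1, hx01⟩ := Z.lev_ex x0
  let P : M → M → Prop := fun y z => E y z ∧ G y z
  have hP : D2 E P := fun t s _ _ => inferInstance
  let g : M → M → Prop := fun y z => LevE E z ∧ P y z ∧ ∀ w, E w z → LevE E w → ¬ P y w
  obtain ⟨J, hJ0, hJ⟩ := Z.iterate g (hG := fun t s _ _ => inferInstance) x1
    (fun x y y' h h' => Z.lev_min_unique (P x) h.1 h'.1 h.2.1 h'.2.1 h.2.2 h'.2.2)
  obtain ⟨J', hJ'⟩ := Z.sep (fun z => LevE E z) (fun t _ => inferInstance) J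
  obtain ⟨X, hX⟩ := Z.union J'
  have hg : ∀ y, E y J' → ∃ z, E z J' ∧ LevE E z ∧ E y z ∧ G y z := by
    intro y hy
    obtain ⟨z, hz1, hz2⟩ := h y
    obtain ⟨m, ⟨hm1, hm2⟩, hmin⟩ := Z.min_ex (fun z => LevE E z ∧ P y z)
      (hP := fun t _ => inferInstance) z ⟨hz1, hz2⟩
    have : E m J := hJ y m ((hJ' y).1 hy).1 ⟨hm1, hm2, fun w h1 h2 h3 => hmin w h1 ⟨h2, h3⟩⟩
    exact ⟨m, (hJ' m).2 ⟨this, hm1⟩, hm1, hm2⟩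
  have hlev : LevE E X := by
    obtain ⟨H, hH⟩ := Z.sep (fun z => LevE E z) (fun t _ => inferInstance) X
    refine ⟨H, Z.lev_of_hist (fun u hu => ((hH u).1 hu).2) ?_, ?_⟩
    · intro u hu w hw hwl
      obtain ⟨y, hy, hy'⟩ := (hX u).1 ((hH u).1 hu).1
      exact (hH w).2 ⟨(hX w).2 ⟨y, hy, Z.lev_trans ((hJ' y).1 hy).2 u hy' w hw⟩, hwl⟩
    · intro x
      constructor
      · intro hx
        obtain ⟨y, hy, hy'⟩ := (hX x).1 hx
        obtain ⟨r, h1, h2, h3⟩ := (Z.lev_acc ((hJ' y).1 hy).2 x).1 hy'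
        exact ⟨r, (hH r).2 ⟨(hX r).2 ⟨y, hy, h1⟩, h2⟩, h3⟩
      · rintro ⟨w, hw, hxw⟩
        obtain ⟨y, hy, hy'⟩ := (hX w).1 ((hH w).1 hw).1
        exact (hX x).2 ⟨y, hy, lev_potent ((hJ' y).1 hy).2 hy' hxw⟩
  refine ⟨X, hlev, (hX x0).2 ⟨x1, (hJ' x1).2 ⟨hJ0, hx1⟩, hx01⟩, fun e he => ?_⟩
  obtain ⟨y, hy, hey⟩ := (hX e).1 he
  obtain ⟨z, hz, hzl, hyz, hG'⟩ := hg y hy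
  obtain ⟨z', hz', _, hzz', _⟩ := hg z hz
  exact ⟨y, z, ((hJ' y).1 hy).2, hzl, hey, hyz, (hX z).2 ⟨z', hz', hzz'⟩, hG'⟩

end ZF

end Paper

namespace Paper

/-! ### Partial satisfaction relations -/

section
variable {M : Type} (E : M → M → Prop)

/-- `e' = e ∪ {⟨i, x⟩}`. -/
def ExtE (e' e i x : M) : Prop := ∀ z, E z e' ↔ (E z e ∨ OPairE E z i x)

/-- `⟨c, ⟨a, b⟩⟩ ∈ P`. -/
def TriE (P c a b : M) : Prop := ∃ q, OPairE E q a b ∧ PairMemE E P c q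

/-- `S` is a correct satisfaction relation over `X` for the formulas coded by `P0, …, P4`. -/
def CorrE (X S P0 P1 P2 P3 P4 : M) : Prop :=
  ∀ e, E e X → ∀ c a b,
    (TriE E P0 c a b → (PairMemE E S c e ↔
      ∃ x y, PairMemE E e a x ∧ PairMemE E e b y ∧ E x y)) ∧
    (TriE E P1 c a b → (PairMemE E S c e ↔
      ∃ x y, PairMemE E e a x ∧ PairMemE E e b y ∧ x = y)) ∧
    (TriE E P2 c a b → ¬ PairMemE E S c e) ∧
    (TriE E P3 c a b → (PairMemE E S c e ↔ (PairMemE E S a e → PairMemE E S b e))) ∧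
    (TriE E P4 c a b → (PairMemE E S c e ↔
      ∀ x, E x X → ∀ e', ExtE E e' e a x → PairMemE E S b e'))

def UE (X P0 P1 P2 P3 P4 root r n0 n1 α A : M) : Prop :=
  SubE E A α ∧ ∃ S e1 e2, CorrE E X S P0 P1 P2 P3 P4 ∧ ExtE E e1 r n0 α ∧
    ExtE E e2 e1 n1 A ∧ PairMemE E S root e2

end

section
variable {J : Type*} {M : J → Type} (E : ∀ j, M j → M j → Prop)

instance dfn_Ext (t1 t2 t3 t4 : ∀ j, (ℕ → M j) → M j) [IsTm t1] [IsTm t2] [IsTm t3] [IsTm t4] :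
    Dfn E (fun j v => ExtE (E j) (t1 j v) (t2 j v) (t3 j v) (t4 j v)) := by
  unfold ExtE; infer_instance

instance dfn_Tri (t1 t2 t3 t4 : ∀ j, (ℕ → M j) → M j) [IsTm t1] [IsTm t2] [IsTm t3] [IsTm t4] :
    Dfn E (fun j v => TriE (E j) (t1 j v) (t2 j v) (t3 j v) (t4 j v)) := by
  unfold TriE; infer_instance

set_option synthInstance.maxHeartbeats 400000 in
set_option synthInstance.maxSize 2000 in
instance dfn_Corr (t1 t2 t3 t4 t5 t6 t7 : ∀ j, (ℕ → M j) → M j) [IsTm t1] [IsTm t2] [IsTm t3]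
    [IsTm t4] [IsTm t5] [IsTm t6] [IsTm t7] :
    Dfn E (fun j v => CorrE (E j) (t1 j v) (t2 j v) (t3 j v) (t4 j v) (t5 j v) (t6 j v)
      (t7 j v)) := by
  unfold CorrE; infer_instance

instance dfn_U (t1 t2 t3 t4 t5 t6 t7 t8 t9 t10 t11 t12 : ∀ j, (ℕ → M j) → M j) [IsTm t1]
    [IsTm t2] [IsTm t3] [IsTm t4] [IsTm t5] [IsTm t6] [IsTm t7] [IsTm t8] [IsTm t9] [IsTm t10]
    [IsTm t11] [IsTm t12] :
    Dfn E (fun j v => UE (E j) (t1 j v) (t2 j v) (t3 j v) (t4 j v) (t5 j v) (t6 j v)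
      (t7 j v) (t8 j v) (t9 j v) (t10 j v) (t11 j v) (t12 j v)) := by
  unfold UE; infer_instance

theorem dfn_fin_ex {ι : Type*} (s : Set ι) (hs : s.Finite) (P : ι → ∀ j, (ℕ → M j) → Prop)
    (hP : ∀ i, Dfn E (P i)) : Dfn E (fun j v => ∃ i ∈ s, P i j v) := by
  induction s, hs using Set.Finite.induction_on with
  | empty => exact (dfn_false E).congr fun j v => by simp
  | @insert a s _ _ ih =>
    have := hP a
    exact (dfn_or E (P a) (fun j v => ∃ i ∈ s, P i j v)).congr fun j v => by simp

theorem dfn_fin_all {ι : Type*} (s : Set ι) (hs : s.Finite) (P : ι → ∀ j, (ℕ → M j) → Prop)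
    (hP : ∀ i, Dfn E (P i)) : Dfn E (fun j v => ∀ i ∈ s, P i j v) := by
  have := dfn_fin_ex E s hs (fun i j v => ¬ P i j v) (fun i => by have := hP i; infer_instance)
  exact (dfn_not E (fun j v => ∃ i ∈ s, ¬ P i j v)).congr fun j v => by simp

end

section
variable {M : Type} (E : M → M → Prop)

/-- Satisfaction for set-sized assignments. -/
def Sat (nm : ℕ → M) : ∀ {n : ℕ}, SetFormula n → M → Prop
  | _, .mem i j, e => ∃ a b, PairMemE E e (nm i) a ∧ PairMemE E e (nm j) b ∧ E a b
  | _, .eq i j, e => ∃ a b, PairMemE E e (nm i) a ∧ PairMemE E e (nm j) b ∧ a = b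
  | _, .fal, _ => False
  | _, .imp φ ψ, e => Sat nm φ e → Sat nm ψ e
  | n, .all φ, e => ∀ a e', ExtE E e' e (nm n) a → Sat nm φ e'

theorem d1_sat (nm : ℕ → M) {n : ℕ} (φ : SetFormula n) : D1 E (Sat E nm φ) := by
  induction φ with
  | mem i j => intro t _; unfold Sat; infer_instance
  | eq i j => intro t _; unfold Sat; infer_instance
  | fal => intro t _; unfold Sat; infer_instance
  | imp φ ψ ih1 ih2 => intro t _; unfold Sat; infer_instance
  | all φ ih => intro t _; unfold Sat; infer_instance

instance dfn_sat (nm : ℕ → M) {n : ℕ} (φ : SetFormula n)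
    (t : Unit → (ℕ → M) → M) [IsTm (J := Unit) (M := fun _ => M) t] :
    Dfn (J := Unit) (M := fun _ => M) (fun _ => E) (fun j v => Sat E nm φ (t j v)) :=
  d1_sat E nm φ t

def Rep (nm : ℕ → M) (n : ℕ) (e : M) (v : Fin n → M) : Prop :=
  ∀ i a, PairMemE E e (nm i) a ↔ ∃ h : i < n, v ⟨i, h⟩ = a

variable {E}

namespace ZF

theorem ext_ex (Z : ZF E) (e i x : M) : ∃ e', ExtE E e' e i x := by
  obtain ⟨p, hp⟩ := Z.opair_ex i x
  obtain ⟨e', he'⟩ := Z.insert_ex e p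
  refine ⟨e', fun z => ?_⟩
  rw [he']
  refine or_congr Iff.rfl ⟨?_, fun h => Z.opair_unique h hp⟩
  rintro rfl
  exact hp

theorem ext_unique (Z : ZF E) {e e1 e2 i x : M} (h1 : ExtE E e1 e i x) (h2 : ExtE E e2 e i x) :
    e1 = e2 := Z.ext _ _ fun z => (h1 z).trans (h2 z).symm

theorem pm_ext (Z : ZF E) {e' e i x : M} (h : ExtE E e' e i x) (j y : M) :
    PairMemE E e' j y ↔ (PairMemE E e j y ∨ (j = i ∧ y = x)) := by
  constructor
  · rintro ⟨p, hp, hp'⟩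
    rcases (h p).1 hp with h1 | h1
    · exact .inl ⟨p, h1, hp'⟩
    · exact .inr (Z.opair_inj hp' h1)
  · rintro (⟨p, hp, hp'⟩ | ⟨rfl, rfl⟩)
    · exact ⟨p, (h p).2 (.inl hp), hp'⟩
    · obtain ⟨p, hp⟩ := Z.opair_ex j y
      exact ⟨p, (h p).2 (.inr hp), hp⟩

theorem rep_ext (Z : ZF E) {nm : ℕ → M} (hnm : Function.Injective nm) {n : ℕ} {e e' a : M}
    {v : Fin n → M} (hr : Rep E nm n e v) (h : ExtE E e' e (nm n) a) :
    Rep E nm (n + 1) e' (Fin.snoc v a) := by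
  intro i b
  rw [Z.pm_ext h, hr i b, hnm.eq_iff]
  constructor
  · rintro (⟨h1, h2⟩ | ⟨rfl, rfl⟩)
    · exact ⟨by omega, by simpa [Fin.snoc, h1] using h2⟩
    · exact ⟨by omega, by simp [Fin.snoc]⟩
  · rintro ⟨h1, h2⟩
    by_cases h3 : i < n
    · exact .inl ⟨h3, by simpa [Fin.snoc, h3] using h2⟩
    · obtain rfl : i = n := by omega
      exact .inr ⟨rfl, by simpa [Fin.snoc] using h2.symm⟩

theorem sat_iff (Z : ZF E) {nm : ℕ → M} (hnm : Function.Injective nm) {n : ℕ}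
    (φ : SetFormula n) : ∀ (e : M) (v : Fin n → M), Rep E nm n e v →
      (Sat E nm φ e ↔ Realize E φ v) := by
  induction φ with
  | mem i j =>
    intro e v hr
    simp only [Sat, Realize, hr _ _, Fin.is_lt, exists_true_left, Fin.eta]
    constructor
    · rintro ⟨a, b, rfl, rfl, h⟩; exact h
    · intro h; exact ⟨_, _, rfl, rfl, h⟩
  | eq i j =>
    intro e v hr
    simp only [Sat, Realize, hr _ _, Fin.is_lt, exists_true_left, Fin.eta]
    constructor
    · rintro ⟨a, b, rfl, rfl, h⟩; exact h
    · intro h; exact ⟨_, _, rfl, rfl, h⟩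
  | fal => intros; rfl
  | imp φ ψ ih1 ih2 =>
    intro e v hr
    simp only [Sat, Realize, ih1 e v hr, ih2 e v hr]
  | @all n φ ih =>
    intro e v hr
    simp only [Sat, Realize]
    refine forall_congr' fun a => ⟨fun h => ?_, fun h e' he' => ?_⟩
    · obtain ⟨e', he'⟩ := Z.ext_ex e (nm n) a
      exact (ih e' _ (Z.rep_ext hnm hr he')).1 (h e' he')
    · exact (ih e' _ (Z.rep_ext hnm hr he')).2 h

end ZF

/-! Subformula-closed sets -/

abbrev Sig := (n : ℕ) × SetFormula n

structure SubCl (s : Set Sig) : Prop where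
  imp : ∀ {n} {φ ψ : SetFormula n}, (⟨n, .imp φ ψ⟩ : Sig) ∈ s → (⟨n, φ⟩ : Sig) ∈ s ∧ (⟨n, ψ⟩ : Sig) ∈ s
  all : ∀ {n} {φ : SetFormula (n + 1)}, (⟨n, .all φ⟩ : Sig) ∈ s → (⟨n + 1, φ⟩ : Sig) ∈ s

theorem subcl_union {s t : Set Sig} (hs : SubCl s) (ht : SubCl t) : SubCl (s ∪ t) := by
  constructor
  · rintro n φ ψ (h | h)
    · exact ⟨.inl (hs.imp h).1, .inl (hs.imp h).2⟩
    · exact ⟨.inr (ht.imp h).1, .inr (ht.imp h).2⟩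
  · rintro n φ (h | h)
    · exact .inl (hs.all h)
    · exact .inr (ht.all h)

theorem subcl_ex {n : ℕ} (φ : SetFormula n) :
    ∃ s : Set Sig, s.Finite ∧ SubCl s ∧ (⟨n, φ⟩ : Sig) ∈ s := by
  induction φ with
  | mem i j =>
    refine ⟨{⟨_, .mem i j⟩}, Set.finite_singleton _, ⟨?_, ?_⟩, rfl⟩ <;> intros <;>
      rename_i h <;> (obtain ⟨rfl, h⟩ := Sigma.mk.inj h; cases h)
  | eq i j =>
    refine ⟨{⟨_, .eq i j⟩}, Set.finite_singleton _, ⟨?_, ?_⟩, rfl⟩ <;> intros <;>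
      rename_i h <;> (obtain ⟨rfl, h⟩ := Sigma.mk.inj h; cases h)
  | @fal n =>
    refine ⟨{⟨n, .fal⟩}, Set.finite_singleton _, ⟨?_, ?_⟩, rfl⟩ <;> intros <;>
      rename_i h <;> (obtain ⟨rfl, h⟩ := Sigma.mk.inj h; cases h)
  | imp φ ψ ih1 ih2 =>
    obtain ⟨s, h1, h2, h3⟩ := ih1
    obtain ⟨t, h1', h2', h3'⟩ := ih2
    have hu := subcl_union h2 h2'
    refine ⟨insert ⟨_, .imp φ ψ⟩ (s ∪ t), (h1.union h1').insert _, ⟨?_, ?_⟩, .inl rfl⟩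
    · rintro n φ' ψ' (h | h)
      · obtain ⟨rfl, h⟩ := Sigma.mk.inj h
        cases h
        exact ⟨.inr (.inl h3), .inr (.inr h3')⟩
      · exact ⟨.inr (hu.imp h).1, .inr (hu.imp h).2⟩
    · rintro n φ' (h | h)
      · obtain ⟨rfl, h⟩ := Sigma.mk.inj h
        cases h
      · exact .inr (hu.all h)
  | all φ ih =>
    obtain ⟨s, h1, h2, h3⟩ := ih
    refine ⟨insert ⟨_, .all φ⟩ s, h1.insert _, ⟨?_, ?_⟩, .inl rfl⟩
    · rintro n φ' ψ' (h | h)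
      · obtain ⟨rfl, h⟩ := Sigma.mk.inj h
        cases h
      · exact ⟨.inr (h2.imp h).1, .inr (h2.imp h).2⟩
    · rintro n φ' (h | h)
      · obtain ⟨rfl, h⟩ := Sigma.mk.inj h
        cases h
        exact .inr h3
      · exact .inr (h2.all h)

def kindOf : Sig → ℕ
  | ⟨_, .mem _ _⟩ => 0
  | ⟨_, .eq _ _⟩ => 1
  | ⟨_, .fal⟩ => 2
  | ⟨_, .imp _ _⟩ => 3
  | ⟨_, .all _⟩ => 4

def argOf (c : Sig → M) (nm : ℕ → M) : Sig → M × M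
  | ⟨_, .mem i j⟩ => (nm i, nm j)
  | ⟨_, .eq i j⟩ => (nm i, nm j)
  | ⟨_, .fal⟩ => (nm 0, nm 0)
  | ⟨n, .imp φ ψ⟩ => (c ⟨n, φ⟩, c ⟨n, ψ⟩)
  | ⟨n, .all φ⟩ => (nm n, c ⟨n + 1, φ⟩)

def bodyOf (E : M → M → Prop) (nm : ℕ → M) : Sig → M → Prop
  | ⟨_, .all φ⟩, e => ¬ Sat E nm φ e
  | _, _ => False

theorem d1_body (nm : ℕ → M) (χ : Sig) : D1 E (bodyOf E nm χ) := by
  obtain ⟨n, φ⟩ := χ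
  cases φ <;> intro t _ <;> unfold bodyOf <;> infer_instance

instance dfn_body (nm : ℕ → M) (χ : Sig)
    (t : Unit → (ℕ → M) → M) [IsTm (J := Unit) (M := fun _ => M) t] :
    Dfn (J := Unit) (M := fun _ => M) (fun _ => E) (fun j v => bodyOf E nm χ (t j v)) :=
  d1_body nm χ t

/-- Codes for a finite set of formulas. -/
def Coded (E : M → M → Prop) (c : Sig → M) (nm : ℕ → M) (s : Set Sig) (t : ℕ) (P : M) : Prop :=
  ∀ x a b, TriE E P x a b ↔ ∃ χ ∈ s, kindOf χ = t ∧ x = c χ ∧ a = (argOf c nm χ).1 ∧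
    b = (argOf c nm χ).2

namespace ZF

theorem coded_ex (Z : ZF E) (c : Sig → M) (nm : ℕ → M) (s : Set Sig) (hs : s.Finite) (t : ℕ) :
    ∃ P, Coded E c nm s t P := by
  choose op hop using Z.opair_ex
  obtain ⟨P, hP⟩ := Z.finite_ex ((fun χ => op (c χ) (op (argOf c nm χ).1 (argOf c nm χ).2)) ''
    {χ ∈ s | kindOf χ = t}) ((hs.subset (Set.sep_subset _ _)).image _)
  refine ⟨P, fun x a b => ?_⟩
  constructor
  · rintro ⟨q, hq, p, hp, hp'⟩
    obtain ⟨χ, ⟨h1, h2⟩, rfl⟩ := (hP p).1 hp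
    obtain ⟨h3, h4⟩ := Z.opair_inj hp' (hop _ _)
    subst h4
    obtain ⟨h5, h6⟩ := Z.opair_inj hq (hop _ _)
    exact ⟨χ, h1, h2, h3, h5, h6⟩
  · rintro ⟨χ, h1, h2, rfl, rfl, rfl⟩
    exact ⟨_, hop _ _, _, (hP _).2 ⟨χ, ⟨h1, h2⟩, rfl⟩, hop _ _⟩

/-- The assumptions on `X` which make satisfaction in `X` agree with satisfaction in `V`. -/
structure Good (E : M → M → Prop) (c : Sig → M) (nm : ℕ → M) (s : Set Sig) (X : M) : Prop where
  cl : ∀ χ ∈ s, ∀ e x e', E e X → E x X → ExtE E e' e (nm χ.1) x → E e' X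
  pr : ∀ χ ∈ s, ∀ e z, E e X → OPairE E z (c χ) e → E z X
  rf : ∀ χ ∈ s, ∀ e, E e X → (∃ x e', ExtE E e' e (nm χ.1) x ∧ bodyOf E nm χ e') →
    ∃ x, E x X ∧ ∃ e', ExtE E e' e (nm χ.1) x ∧ bodyOf E nm χ e'

variable {c : Sig → M} {nm : ℕ → M} {s : Set Sig} {X S P0 P1 P2 P3 P4 : M}

theorem sat_all_iff (g : Good E c nm s X) {n : ℕ} {φ : SetFormula (n + 1)}
    (h : (⟨n, .all φ⟩ : Sig) ∈ s) (hS : ∀ e, E e X → (PairMemE E S (c ⟨n + 1, φ⟩) e ↔ Sat E nm φ e))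
    {e : M} (he : E e X) :
    (∀ x, E x X → ∀ e', ExtE E e' e (nm n) x → PairMemE E S (c ⟨n + 1, φ⟩) e') ↔
      Sat E nm (.all φ) e := by
  constructor
  · intro h1
    by_contra h2
    simp only [Sat] at h2
    push Not at h2
    obtain ⟨x, hx, e', h3, h4⟩ := g.rf _ h e he h2
    exact h4 ((hS e' (g.cl _ h _ _ _ he hx h3)).1 (h1 x hx e' h3))
  · intro h1 x hx e' he'
    exact (hS e' (g.cl _ h _ _ _ he hx he')).2 (h1 x e' he')

theorem corr_unique (hs : SubCl s) (g : Good E c nm s X) (h0 : Coded E c nm s 0 P0)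
    (h1 : Coded E c nm s 1 P1) (h2 : Coded E c nm s 2 P2) (h3 : Coded E c nm s 3 P3)
    (h4 : Coded E c nm s 4 P4) (hS : CorrE E X S P0 P1 P2 P3 P4) {n : ℕ} (φ : SetFormula n) :
    (⟨n, φ⟩ : Sig) ∈ s → ∀ e, E e X → (PairMemE E S (c ⟨n, φ⟩) e ↔ Sat E nm φ e) := by
  induction φ with
  | mem i j =>
    intro hm e he
    exact (hS e he _ _ _).1 ((h0 _ _ _).2 ⟨_, hm, rfl, rfl, rfl, rfl⟩)
  | eq i j =>
    intro hm e he
    exact (hS e he _ _ _).2.1 ((h1 _ _ _).2 ⟨_, hm, rfl, rfl, rfl, rfl⟩)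
  | fal =>
    intro hm e he
    exact iff_false_intro ((hS e he _ _ _).2.2.1 ((h2 _ _ _).2 ⟨_, hm, rfl, rfl, rfl, rfl⟩))
  | imp φ ψ ih1 ih2 =>
    intro hm e he
    refine ((hS e he _ _ _).2.2.2.1 ((h3 _ _ _).2 ⟨_, hm, rfl, rfl, rfl, rfl⟩)).trans ?_
    exact imp_congr (ih1 (hs.imp hm).1 e he) (ih2 (hs.imp hm).2 e he)
  | all φ ih =>
    intro hm e he
    refine ((hS e he _ _ _).2.2.2.2 ((h4 _ _ _).2 ⟨_, hm, rfl, rfl, rfl, rfl⟩)).trans ?_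
    exact sat_all_iff g hm (ih (hs.all hm)) he

theorem corr_of (hs : SubCl s) (g : Good E c nm s X) (h0 : Coded E c nm s 0 P0)
    (h1 : Coded E c nm s 1 P1) (h2 : Coded E c nm s 2 P2) (h3 : Coded E c nm s 3 P3)
    (h4 : Coded E c nm s 4 P4)
    (hS : ∀ χ ∈ s, ∀ e, E e X → (PairMemE E S (c χ) e ↔ Sat E nm χ.2 e)) :
    CorrE E X S P0 P1 P2 P3 P4 := by
  intro e he x a b
  rw [h0, h1, h2, h3, h4]
  refine ⟨?_, ?_, ?_, ?_, ?_⟩ <;> rintro ⟨⟨n, φ⟩, hm, hk, rfl, rfl, rfl⟩ <;>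
    cases φ <;> simp only [kindOf] at hk <;> try omega
  · exact hS _ hm e he
  · exact hS _ hm e he
  · exact fun h => (hS _ hm e he).1 h
  · rename_i φ ψ
    refine (hS _ hm e he).trans ?_
    exact (imp_congr (hS _ (hs.imp hm).1 e he) (hS _ (hs.imp hm).2 e he)).symm
  · rename_i φ
    exact (hS _ hm e he).trans (sat_all_iff g hm (hS _ (hs.all hm)) he).symm

theorem corr_ex (Z : ZF E) (hf : s.Finite) (hc : Set.InjOn c s) (hs : SubCl s)
    (g : Good E c nm s X) (h0 : Coded E c nm s 0 P0)
    (h1 : Coded E c nm s 1 P1) (h2 : Coded E c nm s 2 P2) (h3 : Coded E c nm s 3 P3)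
    (h4 : Coded E c nm s 4 P4) : ∃ S, CorrE E X S P0 P1 P2 P3 P4 := by
  obtain ⟨S, hS⟩ := Z.sep (fun z => ∃ χ ∈ s, ∃ e, OPairE E z (c χ) e ∧ Sat E nm χ.2 e)
    (fun t _ => dfn_fin_ex _ s hf _ fun χ => inferInstance) X
  refine ⟨S, corr_of hs g h0 h1 h2 h3 h4 fun χ hχ e he => ⟨?_, fun h => ?_⟩⟩
  · rintro ⟨p, hp, hp'⟩
    obtain ⟨_, χ', hχ', e', h5, h6⟩ := (hS p).1 hp
    obtain ⟨h7, rfl⟩ := Z.opair_inj hp' h5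
    obtain rfl := hc hχ hχ' h7
    exact h6
  · obtain ⟨p, hp⟩ := Z.opair_ex (c χ) e
    exact ⟨p, (hS p).2 ⟨g.pr χ hχ e p he hp, χ, hχ, e, hp, h⟩, hp⟩

end ZF
end
end Paper

namespace Paper
section
variable {M : Type} {E : M → M → Prop}
namespace ZF

theorem good_ex (Z : ZF E) (c : Sig → M) (nm : ℕ → M) (s : Set Sig) (hs : s.Finite)
    (W : Set M) (hW : W.Finite) :
    ∃ X, LevE E X ∧ (∀ w ∈ W, E w X) ∧ Good E c nm s X ∧
      (∀ e i x e', E e X → E i X → E x X → ExtE E e' e i x → E e' X) := by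
  let B : Sig → M → M → Prop := fun χ e x => ∃ e', ExtE E e' e (nm χ.1) x ∧ bodyOf E nm χ e'
  have hB : ∀ χ, D2 E (B χ) := fun χ t s _ _ => inferInstance
  let Q : M → M → Prop := fun e w => ∀ χ ∈ s, (∃ x, B χ e x) → ∃ x, E x w ∧ B χ e x
  have hQ : D2 E Q := fun t t' _ _ => dfn_fin_all _ s hs _ fun χ => inferInstance
  have hQex : ∀ e, ∃ w, Q e w := by
    intro e
    have : ∀ χ, ∃ x, (∃ x, B χ e x) → B χ e x := by
      intro χ
      by_cases h : ∃ x, B χ e x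
      · obtain ⟨x, hx⟩ := h
        exact ⟨x, fun _ => hx⟩
      · exact ⟨e, fun h' => absurd h' h⟩
    choose f hf using this
    obtain ⟨w, hw⟩ := Z.finite_ex (f '' s) (hs.image _)
    exact ⟨w, fun χ hχ h => ⟨f χ, (hw _).2 ⟨χ, hχ, rfl⟩, hf χ h⟩⟩
  let G : M → M → Prop := fun y z => ∀ e, E e y → ∃ w, E w z ∧ Q e w
  have hG : D2 E G := fun t t' _ _ => inferInstance
  have hGex : ∀ y, ∃ z, LevE E z ∧ E y z ∧ G y z := by
    intro y
    obtain ⟨z, hz, h1⟩ := Z.lev_collect Q (hQ := hQ) y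
    obtain ⟨v, hv, hy⟩ := Z.lev_ex y
    obtain ⟨p, hp⟩ := Z.pair z v
    obtain ⟨u, hu, h2⟩ := Z.lev_above (h := p) (by
      intro w hw
      rcases (hp w).1 hw with rfl | rfl
      · exact hz
      · exact hv)
    have hzu := h2 z ((hp z).2 (.inl rfl))
    have hvu := h2 v ((hp v).2 (.inr rfl))
    refine ⟨u, hu, Z.lev_trans hu v hvu y hy, fun e he => ?_⟩
    obtain ⟨w, hw, hq⟩ := h1 e he (hQex e)
    exact ⟨w, Z.lev_trans hu z hzu w hw, hq⟩
  obtain ⟨x0, hx0⟩ := Z.finite_ex (W ∪ c '' s ∪ (fun χ : Sig => nm χ.1) '' s)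
    ((hW.union (hs.image _)).union (hs.image _))
  obtain ⟨X, hX, hx0X, hcl⟩ := Z.lev_closed G (hG := hG) hGex x0
  have hT := Z.lev_trans hX
  have hin : ∀ w ∈ W ∪ c '' s ∪ (fun χ : Sig => nm χ.1) '' s, E w X :=
    fun w hw => hT x0 hx0X w ((hx0 w).2 hw)
  have two : ∀ a b, E a X → E b X → ∃ y, E y X ∧ E a y ∧ E b y := by
    intro a b ha hb
    obtain ⟨y, z, hy, hz, h1, h2, h3, -⟩ := hcl a ha
    obtain ⟨y', z', hy', hz', h1', h2', h3', -⟩ := hcl b hb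
    have hyX := hT z h3 y h2
    have hyX' := hT z' h3' y' h2'
    rcases Z.lev_cmp y y' hy hy' with h | rfl | h
    · exact ⟨y', hyX', Z.lev_trans hy' y h a h1, h1'⟩
    · exact ⟨y, hyX, h1, h1'⟩
    · exact ⟨y, hyX, h1, Z.lev_trans hy y' h b h1'⟩
  have up : ∀ a b p, E a X → E b X → UPairE E p a b → E p X := by
    intro a b p ha hb hp
    obtain ⟨y, hy, hay, hby⟩ := two a b ha hb
    refine lev_potent hX hy fun z hz => ?_
    rcases (hp z).1 hz with rfl | rfl
    · exact hay
    · exact hby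
  have opp : ∀ a b p, E a X → E b X → OPairE E p a b → E p X := by
    rintro a b p ha hb ⟨u, v, h1, h2, h3⟩
    exact up u v p (up a a u ha ha h1) (up a b v ha hb h2) h3
  have ex : ∀ e i x e', E e X → E i X → E x X → ExtE E e' e i x → E e' X := by
    intro e i x e' he hi hx h
    obtain ⟨p, hp⟩ := Z.opair_ex i x
    obtain ⟨y, hy, hey, hpy⟩ := two e p he (opp i x p hi hx hp)
    obtain ⟨y1, z1, hy1, _, hyy1, h5, h6, _⟩ := hcl y hy
    have hy1X := hT z1 h6 y1 h5
    refine lev_potent hX hy1X fun z hz => ?_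
    have := Z.lev_trans hy1 y hyy1
    rcases (h z).1 hz with h1 | h1
    · exact Z.lev_trans hy1 e (this e hey) z h1
    · rw [Z.opair_unique h1 hp]
      exact this p hpy
  refine ⟨X, hX, fun w hw => hin w (.inl (.inl hw)), ⟨?_, ?_, ?_⟩, ex⟩
  · intro χ hχ e x e' he hx h
    exact ex e _ x e' he (hin _ (.inr ⟨χ, hχ, rfl⟩)) hx h
  · intro χ hχ e z he h
    exact opp _ e z (hin _ (.inl (.inr ⟨χ, hχ, rfl⟩))) he h
  · intro χ hχ e he h
    obtain ⟨y, z, hy, hz, h1, h2, h3, h4⟩ := hcl e he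
    obtain ⟨w, hw, hq⟩ := h4 e h1
    obtain ⟨x, hx, hb⟩ := hq χ hχ h
    exact ⟨x, hT w (hT z h3 w hw) x hx, hb⟩

theorem key (Z : ZF E) {k : ℕ} (φ : SetFormula (k + 2)) (p : Fin k → M) :
    ∃ P0 P1 P2 P3 P4 root r n0 n1, ∀ γ, ∃ X, LevE E X ∧ ∀ α, E α γ → ∀ A, SubE E A α →
      (UE E X P0 P1 P2 P3 P4 root r n0 n1 α A ↔ Realize E φ (Fin.cons α (Fin.cons A p))) := by
  have hinf := Z.infinite
  let nm : ℕ → M := Infinite.natEmbedding M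
  have hnm : Function.Injective nm := (Infinite.natEmbedding M).injective
  -- reorder variables
  let ρ : Fin (k + 2) → Fin (k + 2) := fun i =>
    if i.1 = 0 then ⟨k, by omega⟩ else if i.1 = 1 then ⟨k + 1, by omega⟩ else ⟨i.1 - 2, by omega⟩
  let φ' := φ.rename ρ
  obtain ⟨s, hf, hs, hφ⟩ := subcl_ex φ'
  obtain ⟨cn, hcn⟩ := Set.countable_iff_exists_injOn.1 hf.countable
  let c : Sig → M := fun χ => nm (cn χ)
  have hc : Set.InjOn c s := fun a ha b hb h => hcn ha hb (hnm h)
  obtain ⟨P0, h0⟩ := Z.coded_ex c nm s hf 0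
  obtain ⟨P1, h1⟩ := Z.coded_ex c nm s hf 1
  obtain ⟨P2, h2⟩ := Z.coded_ex c nm s hf 2
  obtain ⟨P3, h3⟩ := Z.coded_ex c nm s hf 3
  obtain ⟨P4, h4⟩ := Z.coded_ex c nm s hf 4
  choose op hop using Z.opair_ex
  obtain ⟨r, hr⟩ := Z.finite_ex (Set.range fun i : Fin k => op (nm i) (p i)) (Set.finite_range _)
  have hrep : Rep E nm k r p := by
    intro i a
    constructor
    · rintro ⟨q, hq, hq'⟩
      obtain ⟨i', rfl⟩ := (hr q).1 hq
      obtain ⟨h5, h6⟩ := Z.opair_inj hq' (hop _ _)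
      obtain rfl := hnm h5
      exact ⟨i'.2, h6.symm⟩
    · rintro ⟨h, rfl⟩
      exact ⟨_, (hr _).2 ⟨⟨i, h⟩, rfl⟩, hop _ _⟩
  refine ⟨P0, P1, P2, P3, P4, c ⟨_, φ'⟩, r, nm k, nm (k + 1), fun γ => ?_⟩
  obtain ⟨X, hX, hW, g, hcl⟩ := Z.good_ex c nm s hf {γ, r, nm k, nm (k + 1)} (Set.toFinite _)
  refine ⟨X, hX, fun α hα A hA => ?_⟩
  have hγX := hW γ (by simp)
  have hαX := Z.lev_trans hX γ hγX α hα
  have hAX := lev_potent hX hαX hA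
  have hrX := hW r (by simp)
  have key : ∀ e1 e2, ExtE E e1 r (nm k) α → ExtE E e2 e1 (nm (k + 1)) A →
      E e2 X ∧ (Sat E nm φ' e2 ↔ Realize E φ (Fin.cons α (Fin.cons A p))) := by
    intro e1 e2 he1 he2
    have h5 := hcl _ _ _ _ hrX (hW (nm k) (by simp)) hαX he1
    refine ⟨hcl _ _ _ _ h5 (hW (nm (k + 1)) (by simp)) hAX he2, ?_⟩
    rw [Z.sat_iff hnm φ' e2 _ (Z.rep_ext hnm (Z.rep_ext hnm hrep he1) he2), realize_rename]
    refine iff_of_eq (congrArg _ ?_)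
    funext i
    refine Fin.cases ?_ (fun i => Fin.cases ?_ (fun i => ?_) i) i
    · simp [ρ, Fin.snoc]
    · simp [ρ, Fin.snoc]
    · simp [ρ, Fin.snoc]
  constructor
  · rintro ⟨_, S, e1, e2, hS, he1, he2, hm⟩
    obtain ⟨h5, h6⟩ := key e1 e2 he1 he2
    exact h6.1 ((corr_unique hs g h0 h1 h2 h3 h4 hS φ' hφ e2 h5).1 hm)
  · intro h
    obtain ⟨S, hS⟩ := Z.corr_ex hf hc hs g h0 h1 h2 h3 h4
    obtain ⟨e1, he1⟩ := Z.ext_ex r (nm k) α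
    obtain ⟨e2, he2⟩ := Z.ext_ex e1 (nm (k + 1)) A
    obtain ⟨h5, h6⟩ := key e1 e2 he1 he2
    exact ⟨hA, S, e1, e2, hS, he1, he2, (corr_unique hs g h0 h1 h2 h3 h4 hS φ' hφ e2 h5).2 (h6.2 h)⟩

end ZF
end
end Paper

namespace Paper

/-! ### The theory -/

section
variable {M : Type} (E : M → M → Prop)

/-- `α` is a limit ordinal outside `C` such that `γ` is the largest element of `C` below `α`. -/
def IntE (C : M → Prop) (γ α : M) : Prop :=
  LimitE E α ∧ ¬ C α ∧ C γ ∧ E γ α ∧ ∀ x, E x α → C x → LeE E x γ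

/-- `F` is a family without coherent pairs on the interval above `γ`. -/
def BadE (C : M → Prop) (F : M → M → Prop) (γ : M) : Prop :=
  (∀ α, IntE E C γ α → (∃ A, F α A) ∧ ∀ A, F α A → SubE E A α) ∧
    ¬ ∃ α β A B, IntE E C γ α ∧ IntE E C γ β ∧ E α β ∧ F β A ∧ InterSpecE E B A α ∧ F α B

def FamE (R : M → M → Prop) : Prop :=
  ∀ α, OrdE E α → (∃ A, R α A) ∧ ∀ A, R α A → SubE E A α

def CohE (R : M → M → Prop) (C : M → Prop) : Prop :=
  ∃ α β A B, C α ∧ C β ∧ E α β ∧ R β A ∧ InterSpecE E B A α ∧ R α B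

def BigE (R : M → M → Prop) (C : M → Prop) : Prop :=
  FamE E R ∧ ClubClassE E C ∧ ¬ CohE E R C ∧
    ∀ P0 P1 P2 P3 P4 root r n0 n1 ξ, OrdE E ξ → ∃ γ, C γ ∧ E ξ γ ∧
      ∀ X, LevE E X → ¬ BadE E C (UE E X P0 P1 P2 P3 P4 root r n0 n1) γ

end

section
variable {J : Type*} {M : J → Type} (E : ∀ j, M j → M j → Prop)

/-- Definable unary predicates depending on further variables. -/
abbrev DD1 (C : ∀ j, (ℕ → M j) → M j → Prop) : Prop :=
  ∀ (f : ℕ → ℕ) (t : ∀ j, (ℕ → M j) → M j) [IsTm t],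
    Dfn E (fun j v => C j (fun i => v (f i)) (t j v))

/-- Definable binary predicates depending on further variables. -/
abbrev DD2 (R : ∀ j, (ℕ → M j) → M j → M j → Prop) : Prop :=
  ∀ (f : ℕ → ℕ) (t s : ∀ j, (ℕ → M j) → M j) [IsTm t] [IsTm s],
    Dfn E (fun j v => R j (fun i => v (f i)) (t j v) (s j v))


variable {E} in
theorem Dfn.subst {P : ∀ j, (ℕ → M j) → Prop} (hP : Dfn E P)
    (s : ℕ → ∀ j, (ℕ → M j) → M j) (hs : ∀ i, IsTm (s i)) :
    Dfn E (fun j v => P j (fun i => s i j v)) := by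
  obtain ⟨n, φ, t, h⟩ := hP
  choose u hu using fun i => (hs i).out
  refine ⟨n, φ, fun i => match t i with | .inl l => u l | .inr c => .inr c, fun j v => ?_⟩
  rw [h]
  refine iff_of_eq (congrArg _ ?_)
  funext i
  rcases hti : t i with l | c
  · simp [tv, hu, hti]
  · simp [tv, hti]

theorem dd1_of (C : ∀ j, (ℕ → M j) → M j → Prop)
    (hC : Dfn E (fun j w => C j (fun i => w (i + 1)) (w 0))) : DD1 E C := by
  intro f t ht
  exact hC.subst (fun i => match i with | 0 => t | i + 1 => fun j v => v (f i))
    (fun i => by cases i <;> infer_instance)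

theorem dd2_of (R : ∀ j, (ℕ → M j) → M j → M j → Prop)
    (hR : Dfn E (fun j w => R j (fun i => w (i + 2)) (w 0) (w 1))) : DD2 E R := by
  intro f t s ht hs
  exact hR.subst (fun i => match i with | 0 => t | 1 => s | i + 2 => fun j v => v (f i))
    (fun i => by rcases i with _ | _ | i <;> infer_instance)

instance dfn_Int (C : ∀ j, (ℕ → M j) → M j → Prop) [hC : Dfn E (fun j w => C j (fun i => w (i + 1)) (w 0))]
    (t1 t2 : ∀ j, (ℕ → M j) → M j) [IsTm t1] [IsTm t2] :
    Dfn E (fun j v => IntE (E j) (C j v) (t1 j v) (t2 j v)) := by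
  unfold IntE
  have := dd1_of E C hC
  infer_instance

instance dfn_Bad (C : ∀ j, (ℕ → M j) → M j → Prop) [hC : Dfn E (fun j w => C j (fun i => w (i + 1)) (w 0))]
    (F : ∀ j, (ℕ → M j) → M j → M j → Prop) [hF : Dfn E (fun j w => F j (fun i => w (i + 2)) (w 0) (w 1))]
    (t1 : ∀ j, (ℕ → M j) → M j) [IsTm t1] :
    Dfn E (fun j v => BadE (E j) (C j v) (F j v) (t1 j v)) := by
  unfold BadE
  have := dd1_of E C hC
  have := dd2_of E F hF
  infer_instance

instance dfn_Fam (R : ∀ j, (ℕ → M j) → M j → M j → Prop) [hR : Dfn E (fun j w => R j (fun i => w (i + 2)) (w 0) (w 1))] :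
    Dfn E (fun j v => FamE (E j) (R j v)) := by
  unfold FamE
  have := dd2_of E R hR
  infer_instance

instance dfn_Coh (C : ∀ j, (ℕ → M j) → M j → Prop) [hC : Dfn E (fun j w => C j (fun i => w (i + 1)) (w 0))]
    (R : ∀ j, (ℕ → M j) → M j → M j → Prop) [hR : Dfn E (fun j w => R j (fun i => w (i + 2)) (w 0) (w 1))] :
    Dfn E (fun j v => CohE (E j) (R j v) (C j v)) := by
  unfold CohE
  have := dd1_of E C hC
  have := dd2_of E R hR
  infer_instance

instance dfn_Club (C : ∀ j, (ℕ → M j) → M j → Prop) [hC : Dfn E (fun j w => C j (fun i => w (i + 1)) (w 0))] :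
    Dfn E (fun j v => ClubClassE (E j) (C j v)) := by
  unfold ClubClassE
  have := dd1_of E C hC
  infer_instance

set_option synthInstance.maxHeartbeats 400000 in
set_option synthInstance.maxSize 2000 in
instance dfn_Big (C : ∀ j, (ℕ → M j) → M j → Prop) [hC : Dfn E (fun j w => C j (fun i => w (i + 1)) (w 0))]
    (R : ∀ j, (ℕ → M j) → M j → M j → Prop) [hR : Dfn E (fun j w => R j (fun i => w (i + 2)) (w 0) (w 1))] :
    Dfn E (fun j v => BigE (E j) (R j v) (C j v)) := by
  unfold BigE
  have := dd1_of E C hC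
  have := dd2_of E R hR
  infer_instance

end
end Paper

namespace Paper

section
variable {J : Type*} {M : J → Type} (E : ∀ j, M j → M j → Prop)

instance dfn_real2 {k : ℕ} (φ : SetFormula (k + 2)) (t1 t2 : ∀ j, (ℕ → M j) → M j)
    (t : Fin k → ∀ j, (ℕ → M j) → M j) [h1 : IsTm t1] [h2 : IsTm t2] [h : ∀ i, IsTm (t i)] :
    Dfn E (fun j v => Realize (E j) φ (Fin.cons (t1 j v) (Fin.cons (t2 j v) (fun i => t i j v)))) := by
  have : ∀ i : Fin (k + 2), IsTm ((Fin.cons t1 (Fin.cons t2 t) : Fin (k + 2) → _) i) := by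
    intro i
    refine Fin.cases ?_ (fun i => Fin.cases ?_ (fun i => ?_) i) i
    · exact h1
    · exact h2
    · exact h i
  refine (dfn_realize E φ (fun i => (Fin.cons t1 (Fin.cons t2 t) : Fin (k + 2) → _) i)).congr
    fun j v => iff_of_eq (congrArg _ ?_)
  funext i
  refine Fin.cases ?_ (fun i => Fin.cases ?_ (fun i => ?_) i) i <;> simp

instance dfn_real1 {k : ℕ} (φ : SetFormula (k + 1)) (t1 : ∀ j, (ℕ → M j) → M j)
    (t : Fin k → ∀ j, (ℕ → M j) → M j) [h1 : IsTm t1] [h : ∀ i, IsTm (t i)] :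
    Dfn E (fun j v => Realize (E j) φ (Fin.cons (t1 j v) (fun i => t i j v))) := by
  have : ∀ i : Fin (k + 1), IsTm ((Fin.cons t1 t : Fin (k + 1) → _) i) := by
    intro i
    refine Fin.cases ?_ (fun i => ?_) i
    · exact h1
    · exact h i
  refine (dfn_realize E φ (fun i => (Fin.cons t1 t : Fin (k + 1) → _) i)).congr
    fun j v => iff_of_eq (congrArg _ ?_)
  funext i
  refine Fin.cases ?_ (fun i => ?_) i <;> simp

end

/-- The family attached to a formula and parameters. -/
abbrev famOf {M : Type} (E : M → M → Prop) {k : ℕ} (φ : SetFormula (k + 2)) (p : Fin k → M) :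
    M → M → Prop := fun α A => Realize E φ (Fin.cons α (Fin.cons A p))

/-- The class of limit ordinals attached to a formula and parameters. -/
abbrev clsOf {M : Type} (E : M → M → Prop) {k : ℕ} (ψ : SetFormula (k + 1)) (p : Fin k → M) :
    M → Prop := fun x => Realize E ψ (Fin.cons x p) ∧ LimitE E x

/-- The sentence `σ` expresses that no parameters satisfy the statement `BigE`. -/
def Expr (k k' : ℕ) (φ : SetFormula (k + 2)) (ψ : SetFormula (k' + 1)) (σ : SetFormula 0) : Prop :=
  ∀ (M : Type) [Nonempty M] (E : M → M → Prop), Realize E σ ![] ↔ ∀ v : ℕ → M,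
    ¬ BigE E (famOf E φ (fun i => v i)) (clsOf E ψ (fun i => v (k + i)))

theorem univ_closure (L : ℕ) (χ : SetFormula L) : ∃ σ : SetFormula 0,
    ∀ (M : Type) (E : M → M → Prop), Realize E σ ![] ↔ ∀ r : Fin L → M, Realize E χ r := by
  induction L with
  | zero =>
    refine ⟨χ, fun M E => ⟨fun h r => ?_, fun h => h _⟩⟩
    rwa [Subsingleton.elim r ![]]
  | succ L ih =>
    obtain ⟨σ, hσ⟩ := ih (.all χ)
    refine ⟨σ, fun M E => ?_⟩
    rw [hσ]
    simp only [Realize]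
    constructor
    · intro h r
      have := h (Fin.init r) (r (Fin.last L))
      rwa [Fin.snoc_init_self] at this
    · intro h r a
      exact h _

theorem expr_ex (k k' : ℕ) (φ : SetFormula (k + 2)) (ψ : SetFormula (k' + 1)) :
    ∃ σ, Expr k k' φ ψ σ := by
  have key : Dfn (J := (M : Type) × (M → M → Prop)) (M := fun j => j.1) (fun j => j.2)
      (fun j v => ¬ BigE j.2 (famOf j.2 φ (fun i => v i)) (clsOf j.2 ψ (fun i => v (k + i)))) := by
    have := dfn_Big (J := (M : Type) × (M → M → Prop)) (M := fun j => j.1) (fun j => j.2)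
      (fun j v => clsOf j.2 ψ (fun i => v (k + i))) (hC := inferInstance)
      (fun j v => famOf j.2 φ (fun i => v i)) (hR := inferInstance)
    exact dfn_not _ _
  obtain ⟨n, χ, t, h⟩ := key
  have ht : ∀ i, ∃ l, t i = .inl l := by
    intro i
    rcases hti : t i with l | c
    · exact ⟨l, rfl⟩
    · exact (c ⟨Empty, fun _ _ => False⟩).elim
  choose g hg using ht
  obtain ⟨L, hL⟩ := (Set.finite_range g).bddAbove
  obtain ⟨σ, hσ⟩ := univ_closure (L + 1) (χ.rename fun i =>
    ⟨g i, Nat.lt_succ_of_le (hL ⟨i, rfl⟩)⟩)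
  refine ⟨σ, fun M hM E => ?_⟩
  obtain ⟨d⟩ := hM
  rw [hσ]
  simp only [realize_rename]
  constructor
  · intro h1 v
    refine (h ⟨M, E⟩ v).2 ?_
    simp only [hg, tv]
    exact h1 (fun i => v i)
  · intro h1 r
    have := (h ⟨M, E⟩ (fun i => if hi : i < L + 1 then r ⟨i, hi⟩ else d)).1
      (h1 (fun i => if hi : i < L + 1 then r ⟨i, hi⟩ else d))
    simp only [hg, tv] at this
    refine Eq.mp (congrArg _ ?_) this
    funext i
    have : g i < L + 1 := Nat.lt_succ_of_le (hL ⟨i, rfl⟩)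
    simp [this]

section
variable {M : Type} {E : M → M → Prop}

theorem part1 (h : IsZFCE E) (hS : OrdSubtleDefE E) (k k' : ℕ) (φ : SetFormula (k + 2))
    (ψ : SetFormula (k' + 1)) (p : Fin k → M) (q : Fin k' → M) :
    ¬ BigE E (famOf E φ p) (clsOf E ψ q) := by
  rintro ⟨h1, h2, h3, -⟩
  obtain ⟨d⟩ := h.1
  obtain ⟨l, χ, r, hχ⟩ := extract2 E (fun x _ => clsOf E ψ q x) (fun t s _ _ => inferInstance) d
  have := hS k (l + 1) φ p χ (Fin.cons d r)
  have he : (fun x => Realize E χ (Fin.cons x (Fin.cons d r))) = clsOf E ψ q :=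
    funext fun x => propext (hχ x d).symm
  rw [he] at this
  exact h3 (this h1 h2)

theorem part3 (Z : ZF E) (R : M → M → Prop) (C : M → Prop) (hB : BigE E R C) :
    OrdFaintDefE E := by
  obtain ⟨-, ⟨hC1, hC2, hC3⟩, -, hB⟩ := hB
  intro k φ p hfam ξ hξ
  obtain ⟨P0, P1, P2, P3, P4, root, r, n0, n1, hkey⟩ := Z.key φ p
  obtain ⟨γ, hγ, hξγ, hbad⟩ := hB P0 P1 P2 P3 P4 root r n0 n1 ξ hξ
  obtain ⟨γ', hγ', hγγ'⟩ := hC2 γ (hC1 γ hγ)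
  obtain ⟨X, hX, hU⟩ := hkey γ'
  have hnt : ∀ α, IntE E C γ α → E α γ' := by
    rintro α ⟨ha, hb, hc, hd, he⟩
    rcases Z.ord_cmp α γ' ha.1 (hC1 _ hγ') with h | rfl | h
    · exact h
    · exact absurd hγ' hb
    · rcases he γ' h hγ' with h1 | rfl
      · exact absurd h1 (Z.asymm _ _ hγγ')
      · exact absurd hγγ' (Z.irrefl _)
  by_contra hcon
  refine hbad X hX ⟨fun α hα => ⟨?_, fun A hA => hA.1⟩, ?_⟩
  · obtain ⟨A, hA⟩ := (hfam α hα.1.1).1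
    exact ⟨A, (hU α (hnt α hα) A ((hfam α hα.1.1).2 A hA)).2 hA⟩
  · rintro ⟨α, β, A, B, hα, hβ, hαβ, hA, hBA, hB⟩
    refine hcon ⟨α, β, A, B, hα.1.1, hβ.1.1, hα.1.1.1 γ hα.2.2.2.1 ξ hξγ, hαβ,
      (hU β (hnt β hβ) A hA.1).1 hA, hBA, (hU α (hnt α hα) B hB.1).1 hB⟩

end
end Paper

namespace Paper

section
variable {M : Type} {E : M → M → Prop}

namespace ZF

theorem succ_ex (Z : ZF E) (x : M) : ∃ y, SuccSpecE E y x := Z.insert_ex x x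

theorem succ_unique (Z : ZF E) {x y y' : M} (h : SuccSpecE E y x) (h' : SuccSpecE E y' x) :
    y = y' := Z.ext _ _ fun z => (h z).trans (h' z).symm

/-- Limit ordinals are closed under successors. -/
theorem limit_succ (Z : ZF E) {l x y : M} (hl : LimitE E l) (hx : E x l) (hy : SuccSpecE E y x) :
    E y l := by
  obtain ⟨b, hb, hxb⟩ := hl.2.2 x hx
  have hbo := ord_mem hl.1 hb
  have hxo := ord_mem hl.1 hx
  have hyo : OrdE E y := by
    constructor
    · intro u hu z hz
      rcases (hy u).1 hu with h | rfl
      · exact (hy z).2 (.inl (hxo.1 u h z hz))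
      · exact (hy z).2 (.inl hz)
    · intro u hu
      rcases (hy u).1 hu with h | rfl
      · exact hxo.2 u h
      · exact hxo.1
  rcases Z.ord_cmp y b hyo hbo with h | rfl | h
  · exact hl.1.1 b hb y h
  · exact hb
  · rcases (hy b).1 h with h | rfl
    · exact absurd hxb (Z.asymm _ _ h)
    · exact absurd hxb (Z.irrefl _)

/-- `b` is of the form `x + 2`. -/
def DS (E : M → M → Prop) (b : M) : Prop := ∃ x y, SuccSpecE E y x ∧ SuccSpecE E b y

def Dec (E : M → M → Prop) (B A α : M) : Prop :=
  SubE E A α ∧ ∀ x, E x α → ∀ y z, SuccSpecE E y x → SuccSpecE E z y → (E x A ↔ E z B)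

theorem limit_not_ds (Z : ZF E) {l : M} (hl : LimitE E l) : ¬ DS E l := by
  rintro ⟨x, y, hy, hz⟩
  obtain ⟨b, hb, hyb⟩ := hl.2.2 y ((hz y).2 (.inr rfl))
  rcases (hz b).1 hb with h | rfl
  · exact Z.asymm _ _ h hyb
  · exact Z.irrefl _ hyb

theorem empty_not_ds {l : M} (hl : EmptyE E l) : ¬ DS E l := by
  rintro ⟨x, y, hy, hz⟩
  exact hl y ((hz y).2 (.inr rfl))

theorem one_not_ds {o l : M} (ho : EmptyE E o) (hl : SuccSpecE E l o) : ¬ DS E l := by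
  rintro ⟨x, y, hy, hz⟩
  rcases (hl y).1 ((hz y).2 (.inr rfl)) with h | rfl
  · exact ho _ h
  · exact ho x ((hy x).2 (.inr rfl))

theorem one_not_limit {o l : M} (ho : EmptyE E o) (hl : SuccSpecE E l o) : ¬ LimitE E l := by
  intro h
  obtain ⟨b, hb, hb'⟩ := h.2.2 o ((hl o).2 (.inr rfl))
  rcases (hl b).1 hb with h | rfl
  · exact ho _ h
  · exact ho _ hb'

theorem zero_mem (Z : ZF E) {o α : M} (ho : EmptyE E o) (hα : OrdE E α) (hne : ∃ w, E w α) :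
    E o α := by
  have hoo : OrdE E o := ⟨fun y hy => absurd hy (ho y), fun y hy => absurd hy (ho y)⟩
  rcases Z.ord_cmp o α hoo hα with h | rfl | h
  · exact h
  · obtain ⟨w, hw⟩ := hne
    exact absurd hw (ho w)
  · exact absurd h (ho _)

theorem dec_ex (Z : ZF E) {o α A t : M} (ho : EmptyE E o) (hα : LimitE E α) (hA : SubE E A α)
    (ht : E t α) (htd : ¬ DS E t) : ∃ B, SubE E B α ∧ E o B ∧ E t B ∧ Dec E B A α ∧
      ∀ b, E b B → b = o ∨ b = t ∨ DS E b := by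
  obtain ⟨B, hB⟩ := Z.sep (fun b => b = o ∨ b = t ∨ ∃ x y, E x A ∧ SuccSpecE E y x ∧
    SuccSpecE E b y) (fun t _ => inferInstance) α
  refine ⟨B, fun z hz => ((hB z).1 hz).1, (hB o).2 ⟨Z.zero_mem ho hα.1 hα.2.1, .inl rfl⟩,
    (hB t).2 ⟨ht, .inr (.inl rfl)⟩, ⟨hA, ?_⟩, ?_⟩
  · intro x hx y z hy hz
    constructor
    · intro hxA
      exact (hB z).2 ⟨Z.limit_succ hα (Z.limit_succ hα hx hy) hz, .inr (.inr ⟨x, y, hxA, hy, hz⟩)⟩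
    · intro hzB
      rcases ((hB z).1 hzB).2 with rfl | rfl | ⟨x', y', h1, h2, h3⟩
      · exact absurd ⟨x, y, hy, hz⟩ (empty_not_ds ho)
      · exact absurd ⟨x, y, hy, hz⟩ htd
      · obtain rfl := Z.succ_inj hz h3
        obtain rfl := Z.succ_inj hy h2
        exact h1
  · intro b hb
    rcases ((hB b).1 hb).2 with h | h | ⟨x, y, _, h1, h2⟩
    · exact .inl h
    · exact .inr (.inl h)
    · exact .inr (.inr ⟨x, y, h1, h2⟩)

theorem dec_inter (Z : ZF E) {α β A A1 B B1 : M} (hα : LimitE E α) (hβ : OrdE E β) (hαβ : E α β)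
    (hA : Dec E A A1 β) (hB : Dec E B B1 α) (h : InterSpecE E B A α) : InterSpecE E B1 A1 α := by
  intro x
  obtain ⟨y, hy⟩ := Z.succ_ex x
  obtain ⟨z, hz⟩ := Z.succ_ex y
  have key : E x α → (E x B1 ↔ E x A1) := by
    intro hx
    rw [hB.2 x hx y z hy hz, hA.2 x (hβ.1 α hαβ x hx) y z hy hz, h z]
    exact ⟨fun h => h.1, fun h => ⟨h, Z.limit_succ hα (Z.limit_succ hα hx hy) hz⟩⟩
  constructor
  · intro h1
    have := hB.1 x h1
    exact ⟨(key this).1 h1, this⟩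
  · rintro ⟨h1, h2⟩
    exact (key h2).2 h1

theorem club_limit (Z : ZF E) (C : M → Prop) [hC : D1 E C] (h : ClubClassE E C) :
    ClubClassE E (fun x => C x ∧ LimitE E x) := by
  obtain ⟨h1, h2, h3⟩ := h
  refine ⟨fun x hx => h1 x hx.1, ?_, ?_⟩
  · intro α hα
    let G : M → M → Prop := fun y z => C z ∧ E y z ∧ ∀ w, E w z → ¬ (C w ∧ E y w)
    obtain ⟨α1, hα1, hαα1⟩ := h2 α hα
    obtain ⟨J, hJ0, hJ⟩ := Z.iterate G (hG := fun t s _ _ => inferInstance) α1 (by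
      rintro x y y' ⟨ha, hb, hc⟩ ⟨ha', hb', hc'⟩
      rcases Z.ord_cmp y y' (h1 _ ha) (h1 _ ha') with h | h | h
      · exact absurd ⟨ha, hb⟩ (hc' _ h)
      · exact h
      · exact absurd ⟨ha', hb'⟩ (hc _ h))
    obtain ⟨J', hJ'⟩ := Z.sep C hC J
    obtain ⟨θ, hθ⟩ := Z.union J'
    have hnext : ∀ y, E y J' → ∃ z, E z J' ∧ E y z := by
      intro y hy
      obtain ⟨hy1, hy2⟩ := (hJ' y).1 hy
      obtain ⟨z, hz, hyz⟩ := h2 y (h1 y hy2)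
      obtain ⟨m, ⟨hm1, hm2⟩, hmin⟩ := Z.min_ex (fun z => C z ∧ E y z)
        (hP := fun t _ => inferInstance) z ⟨hz, hyz⟩
      exact ⟨m, (hJ' m).2 ⟨hJ y m hy1 ⟨hm1, hm2, hmin⟩, hm1⟩, hm2⟩
    have hord : OrdE E θ := by
      constructor
      · intro x hx z hz
        obtain ⟨y, hy, hxy⟩ := (hθ x).1 hx
        exact (hθ z).2 ⟨y, hy, (h1 y ((hJ' y).1 hy).2).1 x hxy z hz⟩
      · intro x hx
        obtain ⟨y, hy, hxy⟩ := (hθ x).1 hx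
        exact (h1 y ((hJ' y).1 hy).2).2 x hxy
    have hαθ : E α θ := (hθ α).2 ⟨α1, (hJ' α1).2 ⟨hJ0, hα1⟩, hαα1⟩
    have hcof : ∀ x, E x θ → ∃ y, C y ∧ E x y ∧ E y θ := by
      intro x hx
      obtain ⟨y, hy, hxy⟩ := (hθ x).1 hx
      obtain ⟨z, hz, hyz⟩ := hnext y hy
      exact ⟨y, ((hJ' y).1 hy).2, hxy, (hθ y).2 ⟨z, hz, hyz⟩⟩
    refine ⟨θ, ⟨h3 θ hord ⟨α, hαθ⟩ hcof, hord, ⟨α, hαθ⟩, fun x hx => ?_⟩, hαθ⟩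
    obtain ⟨y, _, hy1, hy2⟩ := hcof x hx
    exact ⟨y, hy2, hy1⟩
  · intro l hl hne hcof
    refine ⟨h3 l hl hne fun α hα => ?_, hl, hne, fun α hα => ?_⟩
    · obtain ⟨β, hb, hb'⟩ := hcof α hα
      exact ⟨β, hb.1, hb'⟩
    · obtain ⟨β, hb, hb1, hb2⟩ := hcof α hα
      exact ⟨β, hb2, hb1⟩

theorem max_ex (Z : ZF E) (C : M → Prop) [hC : D1 E C] (h : ClubClassE E C) {ξ α : M}
    (hξ : C ξ) (hα : LimitE E α) (hαC : ¬ C α) (hξα : E ξ α) : ∃ γ, IntE E C γ α := by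
  obtain ⟨h1, h2, h3⟩ := h
  obtain ⟨l, ⟨hlo, hl⟩, hmin⟩ := Z.min_ex (fun l => OrdE E l ∧ ∀ x, E x α → C x → E x l)
    (hP := fun t _ => inferInstance) α ⟨hα.1, fun x hx _ => hx⟩
  by_contra hcon
  have hCl : C l := by
    refine h3 l hlo ⟨ξ, hl ξ hξα hξ⟩ fun δ hδ => ?_
    have hδo := ord_mem hlo hδ
    have := hmin δ hδ
    push Not at this
    obtain ⟨x, hx, hCx, hxδ⟩ := this hδo
    have hnm : ¬ ∀ x', E x' α → C x' → LeE E x' x := fun h => hcon ⟨x, hα, hαC, hCx, hx, h⟩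
    push Not at hnm
    obtain ⟨x', hx', hCx', hlt⟩ := hnm
    have hxx' : E x x' := by
      rcases Z.ord_cmp x x' (h1 _ hCx) (h1 _ hCx') with h | rfl | h
      · exact h
      · exact absurd (.inr rfl) hlt
      · exact absurd (.inl h) hlt
    refine ⟨x', hCx', ?_, hl x' hx' hCx'⟩
    rcases Z.ord_cmp δ x hδo (h1 _ hCx) with h | rfl | h
    · exact (h1 _ hCx').1 x hxx' δ h
    · exact hxx'
    · exact absurd h hxδ
  rcases Z.ord_cmp l α hlo hα.1 with h | rfl | h
  · exact Z.irrefl _ (hl l h hCl)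
  · exact hαC hCl
  · exact hmin α h ⟨hα.1, fun x hx _ => hx⟩

end ZF

instance dfn_DS {J : Type*} {M : J → Type} (E : ∀ j, M j → M j → Prop)
    (t1 : ∀ j, (ℕ → M j) → M j) [IsTm t1] : Dfn E (fun j v => ZF.DS (E j) (t1 j v)) := by
  unfold ZF.DS; infer_instance

instance dfn_Dec {J : Type*} {M : J → Type} (E : ∀ j, M j → M j → Prop)
    (t1 t2 t3 : ∀ j, (ℕ → M j) → M j) [IsTm t1] [IsTm t2] [IsTm t3] :
    Dfn E (fun j v => ZF.Dec (E j) (t1 j v) (t2 j v) (t3 j v)) := by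
  unfold ZF.Dec; infer_instance

theorem combine (Z : ZF E) (hFt : OrdFaintDefE E) (C : M → Prop) [hC : D1 E C]
    (hclub : ClubClassE E C) (hlim : ∀ x, C x → LimitE E x) (R F : M → M → Prop) [hR : D2 E R]
    [hF : D2 E F] (hfam : FamE E R) (hno : ¬ CohE E R C) (ξ : M) (hξ : C ξ)
    (hF1 : ∀ γ α, IntE E C γ α → LeE E ξ γ → (∃ A, F α A) ∧ ∀ A, F α A → SubE E A α)
    (hF2 : ∀ γ α β A B, LeE E ξ γ → IntE E C γ α → IntE E C γ β → E α β → F β A →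
      InterSpecE E B A α → F α B → False) : False := by
  obtain ⟨o, ho⟩ := Z.empty_ex
  obtain ⟨l, hl⟩ := Z.succ_ex o
  let E2 : M → M → Prop := fun α B => E ξ α ∧ ¬ LimitE E α ∧ ∃ δ, E δ α ∧
    (∀ x, E x α → LeE E x δ) ∧ ∀ z, E z B ↔ z = δ
  let E3 : M → M → Prop := fun α B => E ξ α ∧ C α ∧ E o B ∧ E l B ∧ ∃ A, ZF.Dec E B A α ∧ R α A
  let E4 : M → M → Prop := fun α B => E ξ α ∧ LimitE E α ∧ ¬ C α ∧ E o B ∧ ¬ E l B ∧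
    ∃ γ, IntE E C γ α ∧ E γ B ∧ (∀ x, E x B → LimitE E x → x = γ) ∧ ∃ A, ZF.Dec E B A α ∧ F α A
  have d2 : D2 E E2 := fun t s _ _ => inferInstance
  have d3 : D2 E E3 := fun t s _ _ => inferInstance
  have d4 : D2 E E4 := fun t s _ _ => inferInstance
  let E' : M → M → Prop := fun α B => SubE E B α ∧ (¬ E ξ α ∨ E2 α B ∨ E3 α B ∨ E4 α B)
  have d' : D2 E E' := fun t s _ _ => inferInstance
  obtain ⟨k, φ, p, hφ⟩ := extract2 E E' d' o
  have hFt := hFt k φ p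
  have he : (fun α A => Realize E φ (Fin.cons α (Fin.cons A p))) = E' := by
    funext x y
    exact propext (hφ x y).symm
  rw [he] at hFt
  have hleγ : ∀ γ α, E ξ α → IntE E C γ α → LeE E ξ γ := fun γ α h h' => h'.2.2.2.2 ξ h hξ
  have hfam' : ∀ α, OrdE E α → (∃ A, E' α A) ∧ ∀ A, E' α A → SubE E A α := by
    intro α hα
    refine ⟨?_, fun A hA => hA.1⟩
    by_cases hξα : E ξ α
    swap
    · exact ⟨o, fun z hz => absurd hz (ho z), .inl hξα⟩
    by_cases hαl : LimitE E α
    swap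
    · have : ∃ δ, E δ α ∧ ∀ β, E β α → ¬ E δ β := by
        by_contra h
        push Not at h
        exact hαl ⟨hα, ⟨ξ, hξα⟩, h⟩
      obtain ⟨δ, hδ, hmax⟩ := this
      obtain ⟨B, hB⟩ := Z.pair δ δ
      have hB' : ∀ z, E z B ↔ z = δ := fun z => by rw [hB z, or_self]
      refine ⟨B, fun z hz => ?_, .inr (.inl ⟨hξα, hαl, δ, hδ, fun x hx => ?_, hB'⟩)⟩
      · rw [(hB' z).1 hz]
        exact hδ
      · rcases Z.ord_cmp x δ (ZF.ord_mem hα hx) (ZF.ord_mem hα hδ) with h | h | h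
        · exact .inl h
        · exact .inr h
        · exact absurd h (hmax x hx)
    have hoα : E o α := Z.zero_mem ho hα ⟨ξ, hξα⟩
    by_cases hαC : C α
    · obtain ⟨A, hA⟩ := (hfam α hα).1
      obtain ⟨B, h1, h2, h3, h4, h5⟩ := Z.dec_ex ho hαl ((hfam α hα).2 A hA)
        (Z.limit_succ hαl hoα hl) (ZF.one_not_ds ho hl)
      exact ⟨B, h1, .inr (.inr (.inl ⟨hξα, hαC, h2, h3, A, h4, hA⟩))⟩
    · obtain ⟨γ, hγ⟩ := Z.max_ex C (hC := hC) hclub hξ hαl hαC hξα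
      have hγl := hlim _ hγ.2.2.1
      obtain ⟨⟨A, hA⟩, hAs⟩ := hF1 γ α hγ (hleγ _ _ hξα hγ)
      obtain ⟨B, h1, h2, h3, h4, h5⟩ := Z.dec_ex ho hαl (hAs A hA) hγ.2.2.2.1
        (Z.limit_not_ds hγl)
      refine ⟨B, h1, .inr (.inr (.inr ⟨hξα, hαl, hαC, h2, ?_, γ, hγ, h3, ?_, A, h4, hA⟩))⟩
      · intro hlB
        rcases h5 l hlB with rfl | rfl | h
        · exact Z.irrefl _ ((hl _).2 (.inr rfl))
        · exact ZF.one_not_limit ho hl hγl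
        · exact ZF.one_not_ds ho hl h
      · intro x hx hxl
        rcases h5 x hx with rfl | h | h
        · obtain ⟨w, hw⟩ := hxl.2.1
          exact absurd hw (ho w)
        · exact h
        · exact absurd h (Z.limit_not_ds hxl)
  obtain ⟨α, β, A, B, hα, hβ, hξα, hαβ, hA, hBA, hB⟩ := hFt hfam' ξ (hlim ξ hξ).1
  · have hξβ := hβ.1 α hαβ ξ hξα
    have hoα : E o α := Z.zero_mem ho hα ⟨ξ, hξα⟩
    -- `α` is not of the second kind unless `o ∉ B`
    have hB0 : E o B → LimitE E α ∧ (E3 α B ∨ E4 α B) := by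
      intro hoB
      rcases hB.2 with h | h | h | h
      · exact absurd hξα h
      · obtain ⟨-, -, δ, hδ, hmax, hBδ⟩ := h
        obtain rfl := (hBδ o).1 hoB
        rcases hmax ξ hξα with h | rfl
        · exact absurd h (ho _)
        · obtain ⟨w, hw⟩ := (hlim _ hξ).2.1
          exact absurd hw (ho w)
      · exact ⟨hlim _ h.2.1, .inl h⟩
      · exact ⟨h.2.1, .inr h⟩
    have main : E o A → (E3 β A ∨ E4 β A) → False := by
      intro hoA hA'
      obtain ⟨hαl, hB'⟩ := hB0 ((hBA o).2 ⟨hoA, hoα⟩)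
      have hlα : E l α := Z.limit_succ hαl hoα hl
      have hlAB : E l B ↔ E l A := by rw [hBA l]; exact and_iff_left hlα
      rcases hA' with hA' | hA' <;> rcases hB' with hB' | hB'
      · obtain ⟨-, hCβ, -, -, A1, hA1, hRA⟩ := hA'
        obtain ⟨-, hCα, -, -, B1, hB1, hRB⟩ := hB'
        exact hno ⟨α, β, A1, B1, hCα, hCβ, hαβ, hRA, Z.dec_inter hαl hβ hαβ hA1 hB1 hBA, hRB⟩
      · exact hB'.2.2.2.2.1 (hlAB.2 hA'.2.2.2.1)
      · exact hA'.2.2.2.2.1 (hlAB.1 hB'.2.2.2.1)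
      · obtain ⟨-, -, -, -, -, γ, hγ, hγA, huA, A1, hA1, hRA⟩ := hA'
        obtain ⟨-, -, -, -, -, γ', hγ', hγB, -, B1, hB1, hRB⟩ := hB'
        obtain rfl := huA γ' ((hBA γ').1 hγB).1 (hlim _ hγ'.2.2.1)
        exact hF2 γ' α β A1 B1 (hleγ _ _ hξα hγ') hγ' hγ hαβ hRA
          (Z.dec_inter hαl hβ hαβ hA1 hB1 hBA) hRB
    rcases hA.2 with h | h | h | h
    · exact h hξβ
    · obtain ⟨-, -, δ, hδ, hmax, hAδ⟩ := h
      have hBe : ∀ z, ¬ E z B := by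
        intro z hz
        obtain ⟨h1, h2⟩ := (hBA z).1 hz
        obtain rfl := (hAδ z).1 h1
        rcases hmax α hαβ with h | rfl
        · exact Z.asymm _ _ h h2
        · exact Z.irrefl _ h2
      rcases hB.2 with h | h | h | h
      · exact h hξα
      · obtain ⟨-, -, δ', -, -, h'⟩ := h
        exact hBe δ' ((h' _).2 rfl)
      · exact hBe _ h.2.2.1
      · exact hBe _ h.2.2.2.1
    · exact main h.2.2.1 (.inl h)
    · exact main h.2.2.2.1 (.inr h)

theorem part2 (Z : ZF E) (hFt : OrdFaintDefE E) (C0 : M → Prop) [hC0 : D1 E C0]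
    (R : M → M → Prop) [hR : D2 E R] (hfam : FamE E R) (hclub0 : ClubClassE E C0)
    (hno : ¬ CohE E R C0) (hnb : ¬ BigE E R (fun x => C0 x ∧ LimitE E x)) : False := by
  let C : M → Prop := fun x => C0 x ∧ LimitE E x
  have hC : D1 E C := fun t _ => inferInstance
  have hclub : ClubClassE E C := Z.club_limit C0 (hC := hC0) hclub0
  have hno' : ¬ CohE E R C := by
    rintro ⟨α, β, A, B, h1, h2, h3⟩
    exact hno ⟨α, β, A, B, h1.1, h2.1, h3⟩
  have : ∃ P0 P1 P2 P3 P4 root r n0 n1 ξ, OrdE E ξ ∧ ∀ γ, C γ → E ξ γ →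
      ∃ X, LevE E X ∧ BadE E C (UE E X P0 P1 P2 P3 P4 root r n0 n1) γ := by
    by_contra hcon
    refine hnb ⟨hfam, hclub, hno', ?_⟩
    intro P0 P1 P2 P3 P4 root r n0 n1 ξ hξ
    by_contra h
    refine hcon ⟨P0, P1, P2, P3, P4, root, r, n0, n1, ξ, hξ, fun γ h1 h2 => ?_⟩
    by_contra h3
    exact h ⟨γ, h1, h2, fun X hX hb => h3 ⟨X, hX, hb⟩⟩
  obtain ⟨P0, P1, P2, P3, P4, root, r, n0, n1, ξ0, hξ0, hbad⟩ := this
  obtain ⟨ξ, hξ, hξ0ξ⟩ := hclub.2.1 ξ0 hξ0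
  let Bd : M → M → Prop := fun X γ => LevE E X ∧ BadE E C (UE E X P0 P1 P2 P3 P4 root r n0 n1) γ
  have dBd : D2 E Bd := fun t s _ _ => inferInstance
  let F : M → M → Prop := fun α A => ∃ γ X, IntE E C γ α ∧ Bd X γ ∧
    (∀ Y, E Y X → LevE E Y → ¬ Bd Y γ) ∧ UE E X P0 P1 P2 P3 P4 root r n0 n1 α A
  have dF : D2 E F := fun t s _ _ => inferInstance
  have huniq : ∀ γ γ' α, IntE E C γ α → IntE E C γ' α → γ = γ' := by
    intro γ γ' α h h'
    rcases h.2.2.2.2 γ' h'.2.2.2.1 h'.2.2.1 with h1 | h1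
    · rcases h'.2.2.2.2 γ h.2.2.2.1 h.2.2.1 with h2 | h2
      · exact absurd h1 (Z.asymm _ _ h2)
      · exact h2
    · exact h1.symm
  refine combine Z hFt C (hC := hC) hclub (fun x hx => hx.2) R F (hR := hR) (hF := dF) hfam hno'
    ξ hξ ?_ ?_
  · intro γ α hγ hle
    have hξ0γ : E ξ0 γ := by
      rcases hle with h | rfl
      · exact (hclub.1 γ hγ.2.2.1).1 ξ h ξ0 hξ0ξ
      · exact hξ0ξ
    refine ⟨?_, ?_⟩
    · obtain ⟨X, hX⟩ := hbad γ hγ.2.2.1 hξ0γ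
      obtain ⟨X, hX, hmin⟩ := Z.min_ex (fun X => Bd X γ) (hP := fun t _ => inferInstance) X hX
      obtain ⟨A, hA⟩ := (hX.2.1 α hγ).1
      exact ⟨A, γ, X, hγ, hX, fun Y hY _ => hmin Y hY, hA⟩
    · rintro A ⟨γ', X, -, -, -, hA⟩
      exact hA.1
  · rintro γ α β A B hle hα hβ hαβ ⟨γ1, X1, h1, h2, h3, h4⟩ hBA ⟨γ2, X2, k1, k2, k3, k4⟩
    obtain rfl := huniq _ _ _ h1 hβ
    obtain rfl := huniq _ _ _ k1 hα
    obtain rfl := Z.lev_min_unique (fun X => Bd X γ2) h2.1 k2.1 h2 k2 h3 k3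
    exact h2.2.2 ⟨α, β, A, B, hα, hβ, hαβ, h4, hBA, k4⟩

end
end Paper


namespace Paper

/-- **Proposition 1.11.** There exists a theory `T` in the language of set theory
such that:
(1) `ZFC + "Ord is essentially subtle"` proves every sentence of `T`;
(2) `ZFC + "Ord is essentially faint" + T` proves the scheme
    "`Ord` is essentially subtle"; and
(3) for every sentence `φ` of `T`, `ZFC + ¬φ` proves the scheme
    "`Ord` is essentially faint".
(By the Gödel completeness theorem, provability is rendered as truth in all
models.) -/
theorem exists_theory_axiomatizing_subtle_over_faint :
    ∃ T : Set (SetFormula 0),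
      (∀ σ ∈ T, ∀ (M : Type) (E : M → M → Prop), IsZFCE E → OrdSubtleDefE E →
        Realize E σ ![]) ∧
      (∀ (M : Type) (E : M → M → Prop), IsZFCE E → OrdFaintDefE E →
        (∀ σ ∈ T, Realize E σ ![]) → OrdSubtleDefE E) ∧
      ∀ σ ∈ T, ∀ (M : Type) (E : M → M → Prop), IsZFCE E → ¬ Realize E σ ![] →
        OrdFaintDefE E := by
  refine ⟨{σ | ∃ k k' φ ψ, Expr k k' φ ψ σ}, ?_, ?_, ?_⟩
  · rintro σ ⟨k, k', φ, ψ, hσ⟩ M E h hS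
    have := h.1
    exact (hσ M E).2 fun v => part1 h hS k k' φ ψ _ _
  · intro M E h hFt hT k k' φ p ψ q hfam hclub
    have hne := h.1
    obtain ⟨d⟩ := hne
    have hne := h.1
    by_contra hno
    obtain ⟨σ, hσ⟩ := expr_ex k k' φ ψ
    have hnb := (hσ M E).1 (hT σ ⟨k, k', φ, ψ, hσ⟩)
      (fun i => if h : i < k then p ⟨i, h⟩ else if h : i - k < k' then q ⟨i - k, h⟩ else d)
    have e1 : (fun i : Fin k => (fun i => if h : i < k then p ⟨i, h⟩ else
        if h : i - k < k' then q ⟨i - k, h⟩ else d : ℕ → M) i) = p := by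
      funext i; simp
    have e2 : (fun i : Fin k' => (fun i => if h : i < k then p ⟨i, h⟩ else
        if h : i - k < k' then q ⟨i - k, h⟩ else d : ℕ → M) (k + i)) = q := by
      funext i; simp
    rw [e1, e2] at hnb
    exact part2 (zf_of_zfc h) hFt (fun x => Realize E ψ (Fin.cons x q))
      (hC0 := fun t _ => inferInstance) (famOf E φ p) (hR := fun t s _ _ => inferInstance)
      hfam hclub hno hnb
  · rintro σ ⟨k, k', φ, ψ, hσ⟩ M E h hn
    have := h.1
    rw [hσ M E] at hn
    push Not at hn
    obtain ⟨v, hv⟩ := hn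
    exact part3 (zf_of_zfc h) _ _ hv

end Paper
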